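/- For every δ > 0 there exist m ∈ ℕ and a first-order sentence φ in the language L_m such that for every α with 0 < α < 1 − δ, the sequence n ↦ P(G(n, n^{−α}) EMSO-satisfies φ) does not converge as n → ∞. -/

import Mathlib

open Filter FirstOrder

noncomputable section

/-! ### The binomial random graph `G(n,p)` -/

/-- The number of edges of a simple graph. -/
noncomputable def edgeCt {n : ℕ} (G : SimpleGraph (Fin n)) : ℕ := Nat.card G.edgeSet

open scoped Classical in
/-- `prob n p Q` is the probability that the binomial random graph `G(n,p)` (on vertex set
`Fin n`) has property `Q`: the sum over all graphs `G` with `Q G` of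
`p^{e(G)} (1-p)^{n(n-1)/2 - e(G)}`. -/
noncomputable def prob (n : ℕ) (p : ℝ) (Q : SimpleGraph (Fin n) → Prop) : ℝ :=
  ∑ G : SimpleGraph (Fin n),
    if Q G then p ^ edgeCt G * (1 - p) ^ (n * (n - 1) / 2 - edgeCt G) else 0

/-- `expec n p W` is the expectation of a real-valued function `W` of the binomial random
graph `G(n,p)`. -/
noncomputable def expec (n : ℕ) (p : ℝ) (W : SimpleGraph (Fin n) → ℝ) : ℝ :=
  ∑ G : SimpleGraph (Fin n),
    W G * (p ^ edgeCt G * (1 - p) ^ (n * (n - 1) / 2 - edgeCt G))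

/-! ### The graphs `W_a^γ` and `W_a^{γ,*}` -/

/-- `ωr r a = (r^a − 1)/(r−1)`, the number of vertices of the perfect `r`-ary tree of
depth `a − 1`. -/
def ωr (r a : ℕ) : ℕ := (r ^ a - 1) / (r - 1)

/-- The depth of the node with (0-based) breadth-first (heap) index `j` in the infinite
`r`-ary tree: the root has index 0, and the parent of node `j ≥ 1` is node `(j−1)/r`. -/
def heapDepth (r : ℕ) : ℕ → ℕ
  | 0 => 0
  | j + 1 => heapDepth r (j / r) + 1
  decreasing_by exact Nat.lt_succ_of_le (Nat.div_le_self _ _)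

/-- The vertex set of `W_a^γ`: the path `F₁` on `a` vertices (`Sum.inl`), together with,
for each of the `(4^a−1)/3` vertices `i` of the perfect 4-ary tree `F₂` (in breadth-first
order), the vertex `(i,0)` of `F₂` itself and the `γ` inner vertices `(i,1),…,(i,γ)` of the
path `P_{γ+2}` joining `i` to the vertex of `F₁` at the same distance from the root. -/
abbrev WVert (γ a : ℕ) := Fin a ⊕ (Fin (ωr 4 a) × Fin (γ + 1))

/-- Base (directed) adjacency relation generating `W_a^γ`: consecutive `F₁`-vertices;
the last inner path vertex `(i,γ)` is joined to the `F₁`-vertex at depth of `i`;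
consecutive vertices along each `P_{γ+2}`; and tree edges of the perfect 4-ary tree
(in heap indexing, `j` is the parent of `i ≥ 1` iff `j = (i−1)/4`). -/
def Wbase (γ a : ℕ) : WVert γ a → WVert γ a → Prop
  | Sum.inl u, Sum.inl v => (v : ℕ) = (u : ℕ) + 1
  | Sum.inl u, Sum.inr iv => (iv.2 : ℕ) = γ ∧ heapDepth 4 (iv.1 : ℕ) = (u : ℕ)
  | Sum.inr _, Sum.inl _ => False
  | Sum.inr iv, Sum.inr jw =>
      (iv.1 = jw.1 ∧ (jw.2 : ℕ) = (iv.2 : ℕ) + 1) ∨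
      ((iv.2 : ℕ) = 0 ∧ (jw.2 : ℕ) = 0 ∧ 1 ≤ (iv.1 : ℕ) ∧ (jw.1 : ℕ) = ((iv.1 : ℕ) - 1) / 4)

/-- The graph `W_a^γ`. -/
def WG (γ a : ℕ) : SimpleGraph (WVert γ a) := SimpleGraph.fromRel (Wbase γ a)

/-- The vertex set of `W_a^{γ,*}` (with `ω₁ = ωr r a`, `ω₂ = ωr r ω₁`), as five pieces:
the path `F₁` on `a` vertices; the tree `F₂` together with the inner vertices of the
paths `P_{γ+2}` joining `F₂` to `F₁` (pairs `(i,k)`, `k = 0` being the `F₂`-vertex itself);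
the `γ` inner vertices of the paths `P_{γ+2}` joining the `i`-th vertex of `F₂` (in
breadth-first order) to the `i`-th vertex of the path `F̃₁`; the path `F̃₁` on `ω₁`
vertices; and the tree `F̃₂` together with the inner vertices of the paths `P_{γ+2}`
joining `F̃₂` to `F̃₁`. -/
abbrev WSVert (γ r a : ℕ) :=
  Fin a ⊕ ((Fin (ωr r a) × Fin (γ + 1)) ⊕ ((Fin (ωr r a) × Fin γ) ⊕
    (Fin (ωr r a) ⊕ (Fin (ωr r (ωr r a)) × Fin (γ + 1)))))

/-- Base (directed) adjacency relation generating `W_a^{γ,*}`. -/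
def WSbase (γ r a : ℕ) : WSVert γ r a → WSVert γ r a → Prop
  | .inl u, .inl v => (v : ℕ) = (u : ℕ) + 1
  | .inl u, .inr (.inl iv) => (iv.2 : ℕ) = γ ∧ heapDepth r (iv.1 : ℕ) = (u : ℕ)
  | .inr (.inl iv), .inr (.inl jw) =>
      (iv.1 = jw.1 ∧ (jw.2 : ℕ) = (iv.2 : ℕ) + 1) ∨
      ((iv.2 : ℕ) = 0 ∧ (jw.2 : ℕ) = 0 ∧ 1 ≤ (iv.1 : ℕ) ∧ (jw.1 : ℕ) = ((iv.1 : ℕ) - 1) / r)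
  | .inr (.inl iv), .inr (.inr (.inl jm)) => (iv.2 : ℕ) = 0 ∧ iv.1 = jm.1 ∧ (jm.2 : ℕ) = 0
  | .inr (.inl iv), .inr (.inr (.inr (.inl d))) => γ = 0 ∧ (iv.2 : ℕ) = 0 ∧ (iv.1 : ℕ) = (d : ℕ)
  | .inr (.inr (.inl im)), .inr (.inr (.inl jm)) => im.1 = jm.1 ∧ (jm.2 : ℕ) = (im.2 : ℕ) + 1
  | .inr (.inr (.inl im)), .inr (.inr (.inr (.inl d))) =>
      (im.2 : ℕ) + 1 = γ ∧ (im.1 : ℕ) = (d : ℕ)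
  | .inr (.inr (.inr (.inl d))), .inr (.inr (.inr (.inl e))) => (e : ℕ) = (d : ℕ) + 1
  | .inr (.inr (.inr (.inl d))), .inr (.inr (.inr (.inr jw))) =>
      (jw.2 : ℕ) = γ ∧ heapDepth r (jw.1 : ℕ) = (d : ℕ)
  | .inr (.inr (.inr (.inr iv))), .inr (.inr (.inr (.inr jw))) =>
      (iv.1 = jw.1 ∧ (jw.2 : ℕ) = (iv.2 : ℕ) + 1) ∨
      ((iv.2 : ℕ) = 0 ∧ (jw.2 : ℕ) = 0 ∧ 1 ≤ (iv.1 : ℕ) ∧ (jw.1 : ℕ) = ((iv.1 : ℕ) - 1) / r)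
  | _, _ => False

/-- The graph `W_a^{γ,*}`. -/
def WSG (γ r a : ℕ) : SimpleGraph (WSVert γ r a) := SimpleGraph.fromRel (WSbase γ r a)

/-- `Vnum γ r a = V_{γ,r}(a) = a + 2(γ+1)ω_r(a) + (γ+1)ω_r(ω_r(a))`,
the number of vertices of `W_a^{γ,*}`. -/
def Vnum (γ r a : ℕ) : ℕ := a + 2 * (γ + 1) * ωr r a + (γ + 1) * ωr r (ωr r a)

/-- `s` is (the vertex set of) an induced copy of `H` in `G`. -/
def IsInducedCopy {V W : Type} (H : SimpleGraph W) (G : SimpleGraph V) (s : Set V) : Prop :=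
  Nonempty (H ≃g G.induce s)

/-! ### The quantities `k_γ` and `f` -/

/-- `kcoef α γ = k_γ = 2(1 − α(γ+2)/(γ+1))`. -/
def kcoef (α : ℝ) (γ : ℕ) : ℝ := 2 * (1 - α * ((γ : ℝ) + 2) / ((γ : ℝ) + 1))

/-- `ff α x = f(x) = x^α · ln x`. -/
def ff (α x : ℝ) : ℝ := x ^ α * Real.log x

/-! ### The language `L_m` and EMSO satisfaction -/

/-- Relation symbols of the language `L_m`: `m` unary symbols and one binary symbol. -/
def LRel (m : ℕ) : ℕ → Type
  | 1 => Fin m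
  | 2 => Unit
  | _ => Empty

/-- The first-order language `L_m`: one binary relation symbol, `m` unary relation symbols
and no function symbols. -/
def Lang (m : ℕ) : Language where
  Functions := fun _ => Empty
  Relations := LRel m

/-- The `L_m`-structure on `Fin n` whose binary relation is adjacency in the graph `G` and
whose `i`-th unary relation is membership in `S i`. -/
def structOf {n m : ℕ} (G : SimpleGraph (Fin n)) (S : Fin m → Set (Fin n)) :
    (Lang m).Structure (Fin n) where
  funMap := fun f _ => Empty.elim f
  RelMap := fun {k} r v =>
    match k, r, v with
    | 1, i, v => v 0 ∈ S i
    | 2, _, v => G.Adj (v 0) (v 1)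
    | 0, r, _ => Empty.elim r
    | (_ + 3), r, _ => Empty.elim r

/-- `G` EMSO-satisfies the `L_m`-sentence `φ`: there are sets `S 0, …, S (m-1)` of vertices
such that the structure on `Fin n` given by adjacency in `G` and membership in the `S i`
satisfies `φ`. -/
def EMSOSat {n m : ℕ} (G : SimpleGraph (Fin n)) (φ : (Lang m).Sentence) : Prop :=
  ∃ S : Fin m → Set (Fin n),
    @FirstOrder.Language.Sentence.Realize (Lang m) (Fin n) (structOf G S) φ

/-! ### Probability on the binomial random graph -/

/-- `DepOn X A` says that `X G` is determined by the presence or absence of the pairs in `A`. -/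
def DepOn {n : ℕ} {β : Type*} (X : SimpleGraph (Fin n) → β) (A : Set (Sym2 (Fin n))) : Prop :=
  ∀ G G' : SimpleGraph (Fin n), (∀ e ∈ A, e ∈ G.edgeSet ↔ e ∈ G'.edgeSet) → X G = X G'

/-- The Bernoulli weight of a bit. -/
def bitWeight (p : ℝ) (b : Bool) : ℝ := if b then p else 1 - p

/-- The product weight of a family of bits. -/
def prodWeight {E : Type*} [Fintype E] (p : ℝ) (ω : E → Bool) : ℝ := ∏ e, bitWeight p (ω e)

theorem sum_prodWeight {E : Type*} [Fintype E] [DecidableEq E] (p : ℝ) :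
    ∑ ω : E → Bool, prodWeight p ω = 1 := by
  unfold prodWeight
  rw [← Fintype.prod_sum (fun (_ : E) b => bitWeight p b)]
  simp [bitWeight]

theorem sum_prodWeight_mul_mul {E : Type*} [Fintype E] [DecidableEq E] (p : ℝ)
    (A : E → Prop) [DecidablePred A] (f g : (E → Bool) → ℝ)
    (hf : ∀ ω ω', (∀ e, A e → ω e = ω' e) → f ω = f ω')
    (hg : ∀ ω ω', (∀ e, ¬ A e → ω e = ω' e) → g ω = g ω') :
    ∑ ω, prodWeight p ω * (f ω * g ω) =
      (∑ ω, prodWeight p ω * f ω) * ∑ ω, prodWeight p ω * g ω := by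
  set Φ := (Equiv.piEquivPiSubtypeProd A (fun _ : E => Bool)).symm with hΦ
  have hw : ∀ x y, prodWeight p (Φ (x, y)) = prodWeight p x * prodWeight p y := by
    intro x y
    unfold prodWeight
    rw [← Fintype.prod_subtype_mul_prod_subtype A]
    congr 1
    · refine Finset.prod_congr rfl fun e _ => ?_
      simp [hΦ, Equiv.piEquivPiSubtypeProd, e.2]
    · refine Finset.prod_congr rfl fun e _ => ?_
      simp [hΦ, Equiv.piEquivPiSubtypeProd, e.2]
  let x₀ : {e // A e} → Bool := fun _ => false
  let y₀ : {e // ¬ A e} → Bool := fun _ => false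
  have hf' : ∀ x y, f (Φ (x, y)) = f (Φ (x, y₀)) := fun x y => hf _ _ fun e he => by
    simp [hΦ, Equiv.piEquivPiSubtypeProd, he]
  have hg' : ∀ x y, g (Φ (x, y)) = g (Φ (x₀, y)) := fun x y => hg _ _ fun e he => by
    simp [hΦ, Equiv.piEquivPiSubtypeProd, he]
  have split : ∀ F : (E → Bool) → ℝ, ∑ ω, prodWeight p ω * F ω =
      ∑ x, ∑ y, prodWeight p x * prodWeight p y * F (Φ (x, y)) := by
    intro F
    rw [← Equiv.sum_comp Φ, Fintype.sum_prod_type]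
    simp only [hw]
  have e1 : ∑ ω, prodWeight p ω * f ω = ∑ x, prodWeight p x * f (Φ (x, y₀)) := by
    rw [split]
    refine Finset.sum_congr rfl fun x _ => ?_
    calc _ = ∑ y, prodWeight p y * (prodWeight p x * f (Φ (x, y₀))) :=
          Finset.sum_congr rfl fun y _ => by rw [hf' x y]; ring
      _ = _ := by rw [← Finset.sum_mul, sum_prodWeight, one_mul]
  have e2 : ∑ ω, prodWeight p ω * g ω = ∑ y, prodWeight p y * g (Φ (x₀, y)) := by
    rw [split, Finset.sum_comm]
    refine Finset.sum_congr rfl fun y _ => ?_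
    calc _ = ∑ x, prodWeight p x * (prodWeight p y * g (Φ (x₀, y))) :=
          Finset.sum_congr rfl fun x _ => by rw [hg' x y]; ring
      _ = _ := by rw [← Finset.sum_mul, sum_prodWeight, one_mul]
  rw [e1, e2, split, Finset.sum_mul_sum]
  refine Finset.sum_congr rfl fun x _ => Finset.sum_congr rfl fun y _ => ?_
  rw [hf' x y, hg' x y]
  ring

/-- The potential edges of a graph on `Fin n`. -/
abbrev PotEdge (n : ℕ) := {e : Sym2 (Fin n) // ¬ e.IsDiag}

open scoped Classical in
/-- A graph on `Fin n` as a family of bits indexed by the potential edges. -/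
def graphBits (n : ℕ) : SimpleGraph (Fin n) ≃ (PotEdge n → Bool) where
  toFun G e := decide (e.1 ∈ G.edgeSet)
  invFun ω := SimpleGraph.fromEdgeSet {e | ∃ h : ¬ e.IsDiag, ω ⟨e, h⟩ = true}
  left_inv G := by
    rw [← SimpleGraph.edgeSet_inj]
    ext e
    simp only [SimpleGraph.edgeSet_fromEdgeSet, Set.mem_sdiff, Set.mem_ofPred_eq, decide_eq_true_eq]
    constructor
    · rintro ⟨⟨_, h⟩, _⟩; exact h
    · intro h
      have := G.not_isDiag_of_mem_edgeSet h
      exact ⟨⟨this, h⟩, this⟩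
  right_inv ω := by
    funext e
    rw [Bool.eq_iff_iff]
    simp only [SimpleGraph.edgeSet_fromEdgeSet, Set.mem_sdiff, Set.mem_ofPred_eq, decide_eq_true_eq]
    constructor
    · rintro ⟨⟨_, h⟩, _⟩; exact h
    · intro h
      exact ⟨⟨e.2, h⟩, e.2⟩

theorem graphBits_apply {n : ℕ} (G : SimpleGraph (Fin n)) (e : PotEdge n) :
    graphBits n G e = true ↔ e.1 ∈ G.edgeSet := by
  simp [graphBits]

theorem mem_edgeSet_symm_graphBits {n : ℕ} (ω : PotEdge n → Bool) (e : Sym2 (Fin n)) :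
    e ∈ ((graphBits n).symm ω).edgeSet ↔ ∃ h : ¬ e.IsDiag, ω ⟨e, h⟩ = true := by
  constructor
  · intro h
    refine ⟨SimpleGraph.not_isDiag_of_mem_edgeSet _ h, ?_⟩
    have := (graphBits_apply ((graphBits n).symm ω) ⟨e, SimpleGraph.not_isDiag_of_mem_edgeSet _ h⟩).2 h
    simpa using this
  · rintro ⟨h, h'⟩
    have := (graphBits_apply ((graphBits n).symm ω) ⟨e, h⟩).1
    simp only [Equiv.apply_symm_apply] at this
    exact this h'

theorem prodWeight_graphBits {n : ℕ} (p : ℝ) (G : SimpleGraph (Fin n)) :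
    prodWeight p (graphBits n G) = p ^ edgeCt G * (1 - p) ^ (n * (n - 1) / 2 - edgeCt G) := by
  classical
  have hE : Fintype.card (PotEdge n) = n * (n - 1) / 2 := by
    rw [Sym2.card_subtype_not_diag, Fintype.card_fin, Nat.choose_two_right]
  have hc : (Finset.univ.filter fun e : PotEdge n => graphBits n G e = true).card = edgeCt G := by
    rw [edgeCt, Nat.card_eq_fintype_card, ← Fintype.card_subtype]
    refine Fintype.card_congr ⟨fun e => ⟨e.1.1, (graphBits_apply G e.1).1 e.2⟩,
      fun e => ⟨⟨e.1, SimpleGraph.not_isDiag_of_mem_edgeSet _ e.2⟩,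
        (graphBits_apply G _).2 e.2⟩, fun _ => rfl, fun _ => rfl⟩
  unfold prodWeight bitWeight
  rw [Finset.prod_ite, Finset.prod_const, Finset.prod_const, hc]
  congr 2
  have := Finset.card_filter_add_card_filter_not (s := (Finset.univ : Finset (PotEdge n)))
    (fun e : PotEdge n => graphBits n G e = true)
  rw [hc, Finset.card_univ, hE] at this
  omega

open scoped Classical in
theorem prob_eq_sum {n : ℕ} (p : ℝ) (Q : SimpleGraph (Fin n) → Prop) :
    prob n p Q = ∑ ω : PotEdge n → Bool,
      prodWeight p ω * if Q ((graphBits n).symm ω) then 1 else 0 := by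
  unfold prob
  rw [← Equiv.sum_comp (graphBits n)]
  refine Finset.sum_congr rfl fun G _ => ?_
  rw [prodWeight_graphBits]
  simp

theorem prob_and {n : ℕ} (p : ℝ) {Q R : SimpleGraph (Fin n) → Prop} {A B : Set (Sym2 (Fin n))}
    (hQ : DepOn Q A) (hR : DepOn R B) (hAB : Disjoint A B) :
    prob n p (fun G => Q G ∧ R G) = prob n p Q * prob n p R := by
  classical
  simp only [prob_eq_sum]
  rw [← sum_prodWeight_mul_mul p (fun e : PotEdge n => e.1 ∈ A)]
  · refine Finset.sum_congr rfl fun ω _ => ?_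
    by_cases h1 : Q ((graphBits n).symm ω) <;> by_cases h2 : R ((graphBits n).symm ω) <;>
      simp [h1, h2]
  · intro ω ω' h
    rw [hQ ((graphBits n).symm ω) ((graphBits n).symm ω')]
    intro e he
    simp only [mem_edgeSet_symm_graphBits]
    exact exists_congr fun h' => by rw [h ⟨e, h'⟩ he]
  · intro ω ω' h
    rw [hR ((graphBits n).symm ω) ((graphBits n).symm ω')]
    intro e he
    simp only [mem_edgeSet_symm_graphBits]
    exact exists_congr fun h' => by rw [h ⟨e, h'⟩ (Set.disjoint_right.1 hAB he)]

theorem prob_true (n : ℕ) (p : ℝ) : prob n p (fun _ => True) = 1 := by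
  classical
  rw [prob_eq_sum]
  simp [sum_prodWeight]

theorem prob_not {n : ℕ} (p : ℝ) (Q : SimpleGraph (Fin n) → Prop) :
    prob n p (fun G => ¬ Q G) = 1 - prob n p Q := by
  classical
  rw [← prob_true n p, eq_sub_iff_add_eq, prob, prob, prob, ← Finset.sum_add_distrib]
  refine Finset.sum_congr rfl fun G _ => ?_
  by_cases h : Q G <;> simp [h]

theorem prob_mono {n : ℕ} {p : ℝ} (h0 : 0 ≤ p) (h1 : p ≤ 1) {Q R : SimpleGraph (Fin n) → Prop}
    (h : ∀ G, Q G → R G) : prob n p Q ≤ prob n p R := by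
  classical
  have h1' : 0 ≤ 1 - p := by linarith
  refine Finset.sum_le_sum fun G _ => ?_
  by_cases hQ : Q G
  · simp [hQ, h G hQ]
  · simp only [hQ, if_false]
    split_ifs <;> positivity

theorem prob_false (n : ℕ) (p : ℝ) : prob n p (fun _ => False) = 0 := by
  simp [prob]

theorem prob_nonneg {n : ℕ} {p : ℝ} (h0 : 0 ≤ p) (h1 : p ≤ 1) (Q : SimpleGraph (Fin n) → Prop) :
    0 ≤ prob n p Q := by
  rw [← prob_false n p]
  exact prob_mono h0 h1 fun _ h => h.elim

theorem prob_or_le {n : ℕ} {p : ℝ} (h0 : 0 ≤ p) (h1 : p ≤ 1) (Q R : SimpleGraph (Fin n) → Prop) :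
    prob n p (fun G => Q G ∨ R G) ≤ prob n p Q + prob n p R := by
  classical
  have h1' : 0 ≤ 1 - p := by linarith
  rw [prob, prob, prob, ← Finset.sum_add_distrib]
  refine Finset.sum_le_sum fun G _ => ?_
  by_cases hQ : Q G <;> by_cases hR : R G <;> simp only [hQ, hR, or_true, or_false, if_true,
    if_false, add_zero, zero_add, le_refl]
  have : 0 ≤ p ^ edgeCt G * (1 - p) ^ (n * (n - 1) / 2 - edgeCt G) := by positivity
  linarith

theorem prob_exists_le {n : ℕ} {p : ℝ} (h0 : 0 ≤ p) (h1 : p ≤ 1) {ι : Type*} (I : Finset ι)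
    (Q : ι → SimpleGraph (Fin n) → Prop) :
    prob n p (fun G => ∃ i ∈ I, Q i G) ≤ ∑ i ∈ I, prob n p (Q i) := by
  classical
  induction I using Finset.induction_on with
  | empty => simp [prob_false]
  | insert i I hi ih =>
    rw [Finset.sum_insert hi]
    simp only [Finset.exists_mem_insert]
    exact (prob_or_le h0 h1 _ _).trans (by gcongr)

theorem prob_exists_disjoint {n : ℕ} {p : ℝ} {ι : Type*} (I : Finset ι)
    (Q : ι → SimpleGraph (Fin n) → Prop)
    (hd : ∀ i ∈ I, ∀ j ∈ I, ∀ G, Q i G → Q j G → i = j) :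
    prob n p (fun G => ∃ i ∈ I, Q i G) = ∑ i ∈ I, prob n p (Q i) := by
  classical
  unfold prob
  rw [Finset.sum_comm]
  refine Finset.sum_congr rfl fun G _ => ?_
  by_cases h : ∃ i ∈ I, Q i G
  · obtain ⟨i, hi, hQ⟩ := h
    rw [if_pos ⟨i, hi, hQ⟩, Finset.sum_eq_single_of_mem i hi, if_pos hQ]
    intro j hj hji
    rw [if_neg fun hQj => hji (hd j hj i hi G hQj hQ)]
  · rw [if_neg h]
    push Not at h
    exact (Finset.sum_eq_zero fun i hi => if_neg (h i hi)).symm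

theorem DepOn.mono {n : ℕ} {β : Type*} {X : SimpleGraph (Fin n) → β} {A B : Set (Sym2 (Fin n))}
    (h : DepOn X A) (hAB : A ⊆ B) : DepOn X B :=
  fun G G' hG => h G G' fun e he => hG e (hAB he)

theorem DepOn.forall_mem {n : ℕ} {ι : Type*} {I : Set ι} {Q : ι → SimpleGraph (Fin n) → Prop}
    {A : Set (Sym2 (Fin n))} (h : ∀ i ∈ I, DepOn (Q i) A) :
    DepOn (fun G => ∀ i ∈ I, Q i G) A :=
  fun G G' hG => by
    refine propext (forall₂_congr fun i hi => ?_)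
    rw [h i hi G G' hG]

theorem depOn_adj {n : ℕ} (u v : Fin n) : DepOn (fun G => G.Adj u v) {s(u, v)} :=
  fun G G' hG => by simpa using hG s(u, v) rfl

theorem prob_forall {n : ℕ} (p : ℝ) {ι : Type*} (I : Finset ι)
    (Q : ι → SimpleGraph (Fin n) → Prop) (A : ι → Set (Sym2 (Fin n)))
    (hQ : ∀ i ∈ I, DepOn (Q i) (A i))
    (hA : ∀ i ∈ I, ∀ j ∈ I, i ≠ j → Disjoint (A i) (A j)) :
    prob n p (fun G => ∀ i ∈ I, Q i G) = ∏ i ∈ I, prob n p (Q i) := by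
  classical
  induction I using Finset.induction_on with
  | empty => simp [prob_true]
  | insert i I hi ih =>
    rw [Finset.prod_insert hi, ← ih (fun j hj => hQ j (Finset.mem_insert_of_mem hj))
      (fun j hj k hk => hA j (Finset.mem_insert_of_mem hj) k (Finset.mem_insert_of_mem hk))]
    simp only [Finset.forall_mem_insert]
    refine prob_and p (hQ i (Finset.mem_insert_self i I)) (B := ⋃ j ∈ I, A j) ?_ ?_
    · refine DepOn.forall_mem (I := (I : Set ι)) fun j hj => ?_
      exact (hQ j (Finset.mem_insert_of_mem hj)).mono (Set.subset_biUnion_of_mem hj)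
    · refine Set.disjoint_iUnion₂_right.2 fun j hj => ?_
      refine hA i (Finset.mem_insert_self i I) j (Finset.mem_insert_of_mem hj) ?_
      rintro rfl
      exact hi hj

theorem prob_adj {n : ℕ} (p : ℝ) {u v : Fin n} (h : u ≠ v) :
    prob n p (fun G => G.Adj u v) = p := by
  classical
  have hd : ¬ (s(u, v) : Sym2 (Fin n)).IsDiag := by simpa using h
  set e₀ : PotEdge n := ⟨s(u, v), hd⟩ with he₀
  have key : ∀ ω : PotEdge n → Bool,
      (prodWeight p ω * if ((graphBits n).symm ω).Adj u v then 1 else 0) =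
        ∏ e, (if e = e₀ then (if ω e then p else 0) else bitWeight p (ω e)) := by
    intro ω
    have hadj : ((graphBits n).symm ω).Adj u v ↔ ω e₀ = true := by
      rw [← SimpleGraph.mem_edgeSet, mem_edgeSet_symm_graphBits]
      exact ⟨fun ⟨_, h⟩ => h, fun h => ⟨hd, h⟩⟩
    unfold prodWeight
    rw [← Finset.mul_prod_erase _ _ (Finset.mem_univ e₀),
      ← Finset.mul_prod_erase _ _ (Finset.mem_univ e₀)]
    have : ∏ e ∈ Finset.univ.erase e₀,
        (if e = e₀ then (if ω e then p else 0) else bitWeight p (ω e)) =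
        ∏ e ∈ Finset.univ.erase e₀, bitWeight p (ω e) :=
      Finset.prod_congr rfl fun e he => if_neg (Finset.ne_of_mem_erase he)
    rw [this]
    by_cases hω : ω e₀ = true <;> simp [hadj, hω, bitWeight]
  rw [prob_eq_sum, Finset.sum_congr rfl fun ω _ => key ω,
    ← Fintype.prod_sum (fun (e : PotEdge n) b =>
      if e = e₀ then (if b then p else 0) else bitWeight p b),
    Finset.prod_eq_single e₀]
  · simp
  · intro e _ he
    simp [he, bitWeight]
  · simp

/-- If `X` and the events `R σ` are determined by disjoint sets of pairs, a bound on the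
probability of every `R σ` bounds the probability of `R X`. -/
theorem prob_comp_le {n : ℕ} {p ε : ℝ} (h0 : 0 ≤ p) (h1 : p ≤ 1) {β : Type*}
    {X : SimpleGraph (Fin n) → β} {R : β → SimpleGraph (Fin n) → Prop} {A B : Set (Sym2 (Fin n))}
    (hX : DepOn X A) (hR : ∀ σ, DepOn (R σ) B) (hAB : Disjoint A B)
    (hε : ∀ σ, prob n p (R σ) ≤ ε) : prob n p (fun G => R (X G) G) ≤ ε := by
  classical
  set J := Finset.univ.image X
  have e1 : prob n p (fun G => R (X G) G) =
      prob n p (fun G => ∃ σ ∈ J, X G = σ ∧ R σ G) := by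
    congr 1
    funext G
    refine propext ⟨fun h => ⟨X G, Finset.mem_image_of_mem X (Finset.mem_univ G), rfl, h⟩, ?_⟩
    rintro ⟨σ, _, rfl, h⟩
    exact h
  have hX' : ∀ σ, DepOn (fun G => X G = σ) A := fun σ G G' hG => by
    beta_reduce
    rw [hX G G' hG]
  have e2 : ∑ σ ∈ J, prob n p (fun G => X G = σ) = 1 := by
    rw [← prob_exists_disjoint J (fun σ G => X G = σ) fun i _ j _ G hi hj => hi.symm.trans hj,
      ← prob_true n p]
    congr 1
    funext G
    exact propext ⟨fun _ => trivial,
      fun _ => ⟨X G, Finset.mem_image_of_mem X (Finset.mem_univ G), rfl⟩⟩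
  rw [e1, prob_exists_disjoint J _ fun i _ j _ G hi hj => hi.1.symm.trans hj.1]
  calc _ = ∑ σ ∈ J, prob n p (fun G => X G = σ) * prob n p (R σ) :=
        Finset.sum_congr rfl fun σ _ => prob_and p (hX' σ) (hR σ) hAB
    _ ≤ ∑ σ ∈ J, prob n p (fun G => X G = σ) * ε :=
        Finset.sum_le_sum fun σ _ =>
          mul_le_mul_of_nonneg_left (hε σ) (prob_nonneg h0 h1 _)
    _ = ε := by rw [← Finset.sum_mul, e2, one_mul]

theorem depOn_adj_iff {n : ℕ} (u v : Fin n) (P : Prop) :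
    DepOn (fun G => G.Adj u v ↔ P) {s(u, v)} :=
  fun G G' hG => congrArg (· ↔ P) (depOn_adj u v G G' hG)

theorem depOn_star {n : ℕ} {γ : Type*} (t : Fin n) (U : Finset (Fin n)) (Q : (Fin n → Prop) → γ)
    (hQ : ∀ P P' : Fin n → Prop, (∀ u ∈ U, P u ↔ P' u) → Q P = Q P') :
    DepOn (fun G => Q fun u => G.Adj t u) {e | ∃ u ∈ U, e = s(t, u)} :=
  fun _ _ hG => hQ _ _ fun u hu => hG s(t, u) ⟨u, hu, rfl⟩

theorem prob_star {n : ℕ} (p : ℝ) {t : Fin n} {U F : Finset (Fin n)} (ht : t ∉ U) (hF : F ⊆ U) :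
    prob n p (fun G => ∀ u ∈ U, (G.Adj t u ↔ u ∈ F)) =
      p ^ F.card * (1 - p) ^ (U.card - F.card) := by
  classical
  rw [prob_forall p U _ (fun u => {s(t, u)}) (fun u _ => depOn_adj_iff t u _)]
  · have : ∀ u ∈ U, prob n p (fun G => G.Adj t u ↔ u ∈ F) = if u ∈ F then p else 1 - p := by
      intro u hu
      have htu : t ≠ u := fun h => ht (h ▸ hu)
      by_cases h : u ∈ F
      · simp [h, prob_adj p htu]
      · simp [h, prob_not, prob_adj p htu]
    rw [Finset.prod_congr rfl this, Finset.prod_ite, Finset.prod_const, Finset.prod_const,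
      Finset.filter_mem_eq_inter, Finset.inter_eq_right.2 hF, Finset.filter_notMem_eq_sdiff,
      Finset.card_sdiff_of_subset hF]
  · intro u _ v _ huv
    rw [Set.disjoint_singleton]
    intro h
    rcases Sym2.eq_iff.1 h with ⟨_, h⟩ | ⟨h, h'⟩
    · exact huv h
    · exact huv (h'.trans h)

theorem prob_star_mem_ge {n : ℕ} {p : ℝ} (h0 : 0 ≤ p) (h1 : p ≤ 1) {t : Fin n}
    {U : Finset (Fin n)} (ht : t ∉ U) (hU : U.card * p ≤ 1 / 2) {k : ℕ}
    {𝓕 : Finset (Finset (Fin n))} (h𝓕 : ∀ F ∈ 𝓕, F ⊆ U ∧ F.card = k) :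
    𝓕.card * p ^ k / 2 ≤
      prob n p (fun G => ∃ F ∈ 𝓕, ∀ u ∈ U, (G.Adj t u ↔ u ∈ F)) := by
  classical
  rw [prob_exists_disjoint 𝓕 (fun F G => ∀ u ∈ U, (G.Adj t u ↔ u ∈ F))]
  · have : ∀ F ∈ 𝓕, p ^ k / 2 ≤ prob n p (fun G => ∀ u ∈ U, (G.Adj t u ↔ u ∈ F)) := by
      intro F hF
      obtain ⟨hFU, hk⟩ := h𝓕 F hF
      rw [prob_star p ht hFU, hk, div_eq_mul_inv]
      gcongr
      calc (2 : ℝ)⁻¹ ≤ 1 + U.card * (-p) := by linarith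
        _ ≤ (1 + -p) ^ U.card := one_add_mul_le_pow (by linarith) _
        _ = (1 - p) ^ U.card := by ring
        _ ≤ _ := pow_le_pow_of_le_one (by linarith) (by linarith) (Nat.sub_le _ _)
    calc (𝓕.card * p ^ k / 2 : ℝ) = ∑ _F ∈ 𝓕, p ^ k / 2 := by
          rw [Finset.sum_const, nsmul_eq_mul]; ring
      _ ≤ _ := Finset.sum_le_sum this
  · intro F hF F' hF' G h h'
    ext u
    by_cases hu : u ∈ U
    · rw [← h u hu, h' u hu]
    · exact ⟨fun h => absurd ((h𝓕 F hF).1 h) hu, fun h => absurd ((h𝓕 F' hF').1 h) hu⟩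

/-- With high probability some vertex of `C` has its neighbourhood in `U` in the family `𝓕`. -/
theorem prob_no_star_le {n : ℕ} {p : ℝ} (h0 : 0 ≤ p) (h1 : p ≤ 1) {C U : Finset (Fin n)}
    (hCU : Disjoint C U) (hU : U.card * p ≤ 1 / 2) {k : ℕ}
    {𝓕 : Finset (Finset (Fin n))} (h𝓕 : ∀ F ∈ 𝓕, F ⊆ U ∧ F.card = k) :
    prob n p (fun G => ∀ t ∈ C, ¬ ∃ F ∈ 𝓕, ∀ u ∈ U, (G.Adj t u ↔ u ∈ F)) ≤
      Real.exp (-(C.card * (𝓕.card * p ^ k / 2))) := by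
  classical
  have hdep : ∀ t ∈ C, DepOn (fun G : SimpleGraph (Fin n) =>
      ¬ ∃ F ∈ 𝓕, ∀ u ∈ U, (G.Adj t u ↔ u ∈ F)) {e | ∃ u ∈ U, e = s(t, u)} := fun t _ =>
    depOn_star t U (fun P => ¬ ∃ F ∈ 𝓕, ∀ u ∈ U, (P u ↔ u ∈ F)) fun P P' h => by
      refine propext (not_congr (exists_congr fun F => and_congr_right fun _ =>
        forall₂_congr fun u hu => ?_))
      rw [h u hu]
  rw [prob_forall p C _ _ hdep]
  · calc _ ≤ ∏ _t ∈ C, Real.exp (-(𝓕.card * p ^ k / 2)) := by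
          refine Finset.prod_le_prod (fun t _ => prob_nonneg h0 h1 _) fun t ht => ?_
          rw [prob_not]
          have := prob_star_mem_ge h0 h1 (Finset.disjoint_left.1 hCU ht) hU h𝓕
          have := Real.add_one_le_exp (-(𝓕.card * p ^ k / 2 : ℝ))
          linarith
      _ = _ := by rw [Finset.prod_const, ← Real.exp_nat_mul]; ring_nf
  · intro t ht t' ht' htt'
    rw [Set.disjoint_left]
    rintro e ⟨u, hu, rfl⟩ ⟨u', hu', h⟩
    rw [Sym2.eq_iff] at h
    rcases h with ⟨h, _⟩ | ⟨h, _⟩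
    · exact htt' h
    · exact Finset.disjoint_left.1 hCU ht (h ▸ hu')

/-- A prescribed pattern of hits of the neighbourhood of `u` on disjoint sets is unlikely. -/
theorem prob_pattern_le {n a b : ℕ} {p : ℝ} (h0 : 0 ≤ p) (h1 : p ≤ 1) (hb : b * p ≤ 1 / 2)
    {u : Fin n} {T : Fin a → Finset (Fin n)} (hu : ∀ x, u ∉ T x) (hT : ∀ x, (T x).card = b)
    (hd : ∀ x y, x ≠ y → Disjoint (T x) (T y)) (τ : Fin a → Prop) :
    prob n p (fun G => ∀ x, ((∃ t ∈ T x, G.Adj u t) ↔ τ x)) ≤ Real.exp (-(a * (b * p))) := by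
  classical
  have hdep : ∀ x ∈ (Finset.univ : Finset (Fin a)), DepOn (fun G : SimpleGraph (Fin n) =>
      ((∃ t ∈ T x, G.Adj u t) ↔ τ x)) {e | ∃ t ∈ T x, e = s(u, t)} := fun x _ =>
    depOn_star u (T x) (fun P => ((∃ t ∈ T x, P t) ↔ τ x)) fun P P' h => by
      refine propext (iff_congr (exists_congr fun t => and_congr_right fun ht => ?_) Iff.rfl)
      rw [h t ht]
  have hmiss : ∀ x, prob n p (fun G => ¬ ∃ t ∈ T x, G.Adj u t) = (1 - p) ^ b := by
    intro x
    have := prob_star p (hu x) (Finset.empty_subset (T x))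
    simp only [Finset.notMem_empty, iff_false, Finset.card_empty, pow_zero, one_mul, hT,
      Nat.sub_zero] at this
    rw [← this]
    congr 1
    funext G
    simp
  have hhit : ∀ x, prob n p (fun G => ∃ t ∈ T x, G.Adj u t) = 1 - (1 - p) ^ b := by
    intro x
    rw [← hmiss x, prob_not]
    ring
  have e1 : (fun G : SimpleGraph (Fin n) => ∀ x, ((∃ t ∈ T x, G.Adj u t) ↔ τ x)) =
      fun G => ∀ x ∈ (Finset.univ : Finset (Fin a)), ((∃ t ∈ T x, G.Adj u t) ↔ τ x) := by
    simp
  rw [e1, prob_forall p Finset.univ _ _ hdep]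
  · calc _ ≤ ∏ _x : Fin a, Real.exp (-(b * p)) := by
          refine Finset.prod_le_prod (fun t _ => prob_nonneg h0 h1 _) fun x _ => ?_
          by_cases hx : τ x
          · simp only [hx, iff_true]
            rw [hhit]
            have h2 := one_add_mul_le_pow (show (-2 : ℝ) ≤ -p by linarith) b
            have h3 := Real.add_one_le_exp (-(b * p) : ℝ)
            rw [show (1 + -p : ℝ) = 1 - p by ring] at h2
            linarith
          · simp only [hx, iff_false]
            rw [hmiss]
            calc (1 - p) ^ b ≤ Real.exp (-p) ^ b :=
                  pow_le_pow_left₀ (by linarith) (by linarith [Real.add_one_le_exp (-p)]) _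
              _ = _ := by rw [← Real.exp_nat_mul]; ring_nf
      _ = _ := by
          rw [Finset.prod_const, Finset.card_univ, Fintype.card_fin, ← Real.exp_nat_mul]
          ring_nf
  · intro x _ y _ hxy
    rw [Set.disjoint_left]
    rintro e ⟨t, ht, rfl⟩ ⟨t', ht', h⟩
    rw [Sym2.eq_iff] at h
    rcases h with ⟨_, h⟩ | ⟨h, _⟩
    · exact Finset.disjoint_left.1 (hd x y hxy) ht (h ▸ ht')
    · exact hu y (h ▸ ht')

/-- Every second term of the tower function: `0, 2, 16, …`. -/
def tow : ℕ → ℕ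
  | 0 => 0
  | i + 1 => 2 ^ 2 ^ tow i

theorem lt_tow_succ (i : ℕ) : tow i < tow (i + 1) :=
  Nat.lt_two_pow_self.trans Nat.lt_two_pow_self

theorem tow_strictMono : StrictMono tow := strictMono_nat_of_lt_succ lt_tow_succ

/-- `Bit` identifies the segment of `m'` with the power set of the segment of `m`. -/
def PowRel {V : Type*} (Seg Bit : V → V → Prop) (m m' : V) : Prop :=
  (∀ x x', Seg x m' → Seg x' m' → ¬ x = x' → ∃ y, Seg y m ∧ ¬ (Bit x y ↔ Bit x' y)) ∧
  (∃ x, Seg x m' ∧ ∀ y, Seg y m → ¬ Bit x y) ∧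
  ∀ x y, Seg x m' → Seg y m →
    ∃ x', Seg x' m' ∧ ∀ y', Seg y' m → (Bit x' y' ↔ (Bit x y' ∨ y' = y))

open scoped Classical in
theorem PowRel.card_eq {V : Type*} [Fintype V] {Seg Bit : V → V → Prop} {m m' : V}
    (h : PowRel Seg Bit m m') :
    (Finset.univ.filter (Seg · m')).card = 2 ^ (Finset.univ.filter (Seg · m)).card := by
  obtain ⟨hinj, ⟨x₀, hx₀, hx₀'⟩, hstep⟩ := h
  rw [← Finset.card_powerset]
  have himg : (Finset.univ.filter (Seg · m')).image
      (fun x => Finset.univ.filter fun y => Seg y m ∧ Bit x y) =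
        (Finset.univ.filter (Seg · m)).powerset := by
    apply Finset.Subset.antisymm
    · intro A hA
      obtain ⟨x, -, rfl⟩ := Finset.mem_image.1 hA
      rw [Finset.mem_powerset]
      exact Finset.monotone_filter_right _ fun y _ hy => hy.1
    · intro A hA
      rw [Finset.mem_powerset] at hA
      induction A using Finset.induction_on with
      | empty =>
        refine Finset.mem_image.2 ⟨x₀, by simpa using hx₀, ?_⟩
        rw [Finset.filter_eq_empty_iff]
        exact fun y _ hy => hx₀' y hy.1 hy.2
      | insert y A _ ih =>
        obtain ⟨x, hx, rfl⟩ := Finset.mem_image.1 (ih ((Finset.subset_insert _ _).trans hA))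
        have hy : Seg y m := by simpa using hA (Finset.mem_insert_self _ _)
        obtain ⟨x', hx', hb⟩ := hstep x y (by simpa using hx) hy
        refine Finset.mem_image.2 ⟨x', by simpa using hx', ?_⟩
        ext y'
        simp only [Finset.mem_filter, Finset.mem_univ, true_and, Finset.mem_insert]
        constructor
        · rintro ⟨h1, h2⟩
          rcases (hb y' h1).1 h2 with h | h
          · exact Or.inr ⟨h1, h⟩
          · exact Or.inl h
        · rintro (rfl | ⟨h1, h2⟩)
          · exact ⟨hy, (hb _ hy).2 (Or.inr rfl)⟩
          · exact ⟨h1, (hb _ h1).2 (Or.inl h2)⟩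
  rw [← himg, Finset.card_image_of_injOn]
  intro x hx x' hx' hxx'
  by_contra hne
  obtain ⟨y, hy, hb⟩ := hinj x x' (by simpa using hx) (by simpa using hx') hne
  have := Finset.ext_iff.1 hxx' y
  simp only [Finset.mem_filter, Finset.mem_univ, true_and, hy] at this
  exact hb this

/-- The marked segments form a tower ending with the whole of `X`. -/
def TowerCert {V : Type*} (Seg Bit : V → V → Prop) (X Mk : Set V) : Prop :=
  (∀ m', m' ∈ Mk → ((∀ x, ¬ Seg x m') ∨
    ∃ m, m ∈ Mk ∧ ∃ m'', PowRel Seg Bit m m'' ∧ PowRel Seg Bit m'' m')) ∧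
  ∃ m, m ∈ Mk ∧ ∀ x, Seg x m ↔ x ∈ X

open scoped Classical in
theorem TowerCert.card_mem {V : Type*} [Fintype V] {Seg Bit : V → V → Prop} {X Mk : Set V}
    (h : TowerCert Seg Bit X Mk) : (Finset.univ.filter (· ∈ X)).card ∈ Set.range tow := by
  have key : ∀ k m, m ∈ Mk → (Finset.univ.filter (Seg · m)).card = k → k ∈ Set.range tow := by
    intro k
    induction k using Nat.strong_induction_on with
    | _ k ih =>
      intro m' hm' hk
      rcases h.1 m' hm' with h0 | ⟨m, hm, m'', h1, h2⟩
      · exact ⟨0, by rw [← hk, Finset.filter_false_of_mem fun x _ => h0 x]; rfl⟩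
      · rw [h2.card_eq, h1.card_eq] at hk
        obtain ⟨i, hi⟩ := ih _ (by rw [← hk]; exact Nat.lt_two_pow_self.trans Nat.lt_two_pow_self) m hm rfl
        exact ⟨i + 1, by rw [← hk, ← hi]; rfl⟩
  obtain ⟨m, hm, hX⟩ := h.2
  refine key _ m hm ?_
  congr 1
  ext x
  simp [hX]

/-! ### Trees of neighbourhoods -/

section Trees

variable {V : Type*}

/-- `t` belongs to the `j`-th level of the tree rooted at `x`. -/
def Bel (G : SimpleGraph V) (F : ℕ → Set V) : ℕ → V → V → Prop
  | 0, t, x => t ∈ F 0 ∧ t = x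
  | j + 1, t, x => t ∈ F (j + 1) ∧ ∃ s, G.Adj t s ∧ Bel G F j s x

/-- `t ∈ T` hangs below the `j`-th level of the tree rooted at `x`. -/
def BelT (G : SimpleGraph V) (F : ℕ → Set V) (r j : ℕ) (t x : V) : Prop :=
  t ∈ F r ∧ ∃ s, G.Adj t s ∧ Bel G F j s x

/-- `u` has a neighbour in the `j`-th level of the tree rooted at `x`. -/
def Lk (G : SimpleGraph V) (F : ℕ → Set V) (j : ℕ) (u x : V) : Prop :=
  ∃ t, G.Adj u t ∧ Bel G F j t x

/-- `u` has a neighbour in `F r` which hangs below the `j`-th level of the tree rooted at `x`. -/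
def LkT (G : SimpleGraph V) (F : ℕ → Set V) (r j : ℕ) (u x : V) : Prop :=
  ∃ t, G.Adj u t ∧ BelT G F r j t x

/-- The binary relation on the roots encoded by `F r`. -/
def WRel (G : SimpleGraph V) (F : ℕ → Set V) (K r : ℕ) (x y : V) : Prop :=
  ∃ w, w ∈ F r ∧ Lk G F K w x ∧ Lk G F (K + 1) w y

/-- The set `F 0` is a logarithmic-size set whose cardinality is a tower. -/
def Cert (G : SimpleGraph V) (F : ℕ → Set V) (K : ℕ) : Prop :=
  TowerCert (WRel G F K (K + 4)) (WRel G F K (K + 5)) (F 0) (F (K + 6)) ∧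
  ∀ u v, ¬ u = v → ∃ x, ¬ (LkT G F (K + 2) (K + 1) u x ↔ LkT G F (K + 2) (K + 1) v x) ∨
    ¬ (LkT G F (K + 3) K u x ↔ LkT G F (K + 3) K v x)

theorem Bel.mem_root {G : SimpleGraph V} {F : ℕ → Set V} {j : ℕ} {t x : V} (h : Bel G F j t x) :
    x ∈ F 0 := by
  induction j generalizing t with
  | zero => exact h.2 ▸ h.1
  | succ j ih => obtain ⟨_, s, _, hs⟩ := h; exact ih hs

theorem LkT.mem_root {G : SimpleGraph V} {F : ℕ → Set V} {r j : ℕ} {u x : V}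
    (h : LkT G F r j u x) : x ∈ F 0 := by
  obtain ⟨_, _, _, _, _, h⟩ := h
  exact h.mem_root

open scoped Classical in
theorem Cert.card_le [Fintype V] {G : SimpleGraph V} {F : ℕ → Set V} {K : ℕ} (h : Cert G F K) :
    Fintype.card V ≤ 4 ^ (Finset.univ.filter (· ∈ F 0)).card := by
  set X := Finset.univ.filter (· ∈ F 0) with hX
  have hmem : ∀ x, x ∈ X ↔ x ∈ F 0 := by simp [hX]
  let code : V → Finset V × Finset V := fun u =>
    (X.filter fun x => LkT G F (K + 2) (K + 1) u x, X.filter fun x => LkT G F (K + 3) K u x)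
  have hinj : Function.Injective code := by
    intro u v huv
    by_contra hne
    obtain ⟨h1, h2⟩ := Prod.ext_iff.1 huv
    obtain ⟨x, hx | hx⟩ := h.2 u v hne
    · have := Finset.ext_iff.1 h1 x
      by_cases hxX : x ∈ X
      · simp only [code, Finset.mem_filter, hxX, true_and] at this
        exact hx this
      · exact hx ⟨fun h => absurd ((hmem x).2 h.mem_root) hxX,
          fun h => absurd ((hmem x).2 h.mem_root) hxX⟩
    · have := Finset.ext_iff.1 h2 x
      by_cases hxX : x ∈ X
      · simp only [code, Finset.mem_filter, hxX, true_and] at this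
        exact hx this
      · exact hx ⟨fun h => absurd ((hmem x).2 h.mem_root) hxX,
          fun h => absurd ((hmem x).2 h.mem_root) hxX⟩
  have := Finset.card_le_card_of_injOn (s := Finset.univ) (t := X.powerset ×ˢ X.powerset) code
    (fun u _ => by
      rw [Finset.mem_coe, Finset.mem_product, Finset.mem_powerset, Finset.mem_powerset]
      exact ⟨Finset.filter_subset _ _, Finset.filter_subset _ _⟩) hinj.injOn
  rw [Finset.card_product, Finset.card_powerset, ← mul_pow] at this
  simpa using this

end Trees

theorem four_pow_add_one_lt {k : ℕ} (hk : 3 ≤ k) : 4 ^ k + 1 < 2 ^ 2 ^ k := by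
  have h6 : 2 * k + 1 < 2 ^ k := by
    induction k, hk using Nat.le_induction with
    | base => norm_num
    | succ k hk ih => rw [pow_succ]; omega
  have h7 : 2 ^ (2 * k + 1) ≤ 2 ^ 2 ^ k := Nat.pow_le_pow_right (by norm_num) h6.le
  have h8 : 4 ^ k = 2 ^ (2 * k) := by rw [pow_mul]; norm_num
  have h9 : 1 < 2 ^ (2 * k) := Nat.one_lt_two_pow (by omega)
  rw [pow_succ] at h7
  omega

/-- Graphs whose order is slightly larger than a power of four to a tower have no
certificate. -/
theorem not_cert {i : ℕ} {G : SimpleGraph (Fin (4 ^ tow (i + 2) + 1))}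
    {F : ℕ → Set (Fin (4 ^ tow (i + 2) + 1))} {K : ℕ} : ¬ Cert G F K := by
  classical
  intro h
  obtain ⟨j, hj⟩ := h.1.card_mem
  have h1 := h.card_le
  have h2 := Finset.card_le_univ (Finset.univ.filter (· ∈ F 0))
  rw [Fintype.card_fin] at h1 h2
  rw [← hj] at h1 h2
  have h3 : tow (i + 2) < tow j := by
    by_contra! h3
    have := Nat.pow_le_pow_right (show 4 > 0 by norm_num) h3
    omega
  have h4 : tow (i + 3) ≤ tow j :=
    tow_strictMono.monotone (tow_strictMono.lt_iff_lt.1 h3)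
  have h5 : tow 2 ≤ tow (i + 2) := tow_strictMono.monotone (by omega)
  have h6 : tow 2 = 16 := rfl
  have := four_pow_add_one_lt (show 3 ≤ tow (i + 2) by omega)
  have h7 : tow (i + 3) = 2 ^ 2 ^ tow (i + 2) := rfl
  omega

/-- The tower function `0, 1, 2, 4, 16, …`. -/
def twr : ℕ → ℕ
  | 0 => 0
  | i + 1 => 2 ^ twr i

theorem twr_two_mul (i : ℕ) : twr (2 * i) = tow i := by
  induction i with
  | zero => rfl
  | succ i ih => rw [← show 2 ^ 2 ^ twr (2 * i) = twr (2 * (i + 1)) from rfl, ih]; rfl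

theorem twr_strictMono : StrictMono twr := strictMono_nat_of_lt_succ fun _ => Nat.lt_two_pow_self

theorem two_mul_lt_tow {k : ℕ} (hk : 2 ≤ k) : 2 * k < tow k := by
  induction k, hk using Nat.le_induction with
  | base => show 4 < 16; norm_num
  | succ k hk ih =>
    have h1 : tow k + 1 ≤ 2 ^ tow k := Nat.lt_two_pow_self
    have h2 : 2 ^ tow k + 1 ≤ 2 ^ 2 ^ tow k := Nat.lt_two_pow_self
    have h3 : tow (k + 1) = 2 ^ 2 ^ tow k := rfl
    omega

theorem powRel_twr {a : ℕ} {i j k : Fin a} (hj : (j : ℕ) = i + 1) (hk : twr j ≤ a) :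
    PowRel (fun x i : Fin a => (x : ℕ) < twr i) (fun x y => Nat.testBit x y = true) i j := by
  have htj : twr j = 2 ^ twr i := by rw [hj]; rfl
  have hia : twr i ≤ a := (twr_strictMono.monotone (by omega : (i : ℕ) ≤ j)).trans hk
  refine ⟨?_, ?_, ?_⟩
  · intro x x' hx hx' hne
    simp only [htj] at hx hx'
    by_contra! hall
    apply hne
    ext
    apply Nat.eq_of_testBit_eq
    intro l
    rcases lt_or_ge l (twr i) with hl | hl
    · exact Bool.eq_iff_iff.2 (hall ⟨l, hl.trans_le hia⟩ hl)
    · rw [Nat.testBit_lt_two_pow (hx.trans_le (Nat.pow_le_pow_right (by norm_num) hl)),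
        Nat.testBit_lt_two_pow (hx'.trans_le (Nat.pow_le_pow_right (by norm_num) hl))]
  · exact ⟨⟨0, k.pos⟩, by simp [htj], by simp⟩
  · intro x y hx hy
    simp only [htj] at hx hy ⊢
    have hlt : (x : ℕ) ||| 2 ^ (y : ℕ) < 2 ^ twr i :=
      Nat.or_lt_two_pow hx (Nat.pow_lt_pow_right (by norm_num) hy)
    refine ⟨⟨_, hlt.trans_le (htj ▸ hk)⟩, hlt, fun y' _ => ?_⟩
    simp only [Nat.testBit_or, Nat.testBit_two_pow, Bool.or_eq_true, decide_eq_true_eq, Fin.ext_iff]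
    rw [eq_comm (a := (y : ℕ))]

theorem exists_towerCert {k : ℕ} (hk : 2 ≤ k) :
    ∃ (Seg Bit : Fin (tow k) → Fin (tow k) → Prop) (Mk : Set (Fin (tow k))),
      TowerCert Seg Bit Set.univ Mk := by
  have h2k := two_mul_lt_tow hk
  refine ⟨fun x i => (x : ℕ) < twr i, fun x y => Nat.testBit x y = true,
    {i | ∃ j, (i : ℕ) = 2 * j ∧ j ≤ k}, ?_, ⟨2 * k, h2k⟩, ⟨k, rfl, le_rfl⟩, fun x => ?_⟩
  · rintro i ⟨j, hj, hjk⟩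
    rcases j with - | j
    · left
      intro x
      simp [hj, twr]
    · right
      have hle : ∀ l, l ≤ 2 * k → twr l ≤ tow k := fun l hl => by
        rw [← twr_two_mul]; exact twr_strictMono.monotone hl
      exact ⟨⟨2 * j, by omega⟩, ⟨j, rfl, by omega⟩, ⟨2 * j + 1, by omega⟩,
        powRel_twr (k := i) rfl (hle _ (by simp only; omega)),
        powRel_twr (k := i) (by simp only; omega) (hle _ (by omega))⟩
  · simp [twr_two_mul]

theorem PowRel.map {W V : Type*} {Seg Bit : W → W → Prop} {Seg' Bit' : V → V → Prop} {root : W → V}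
    (hroot : Function.Injective root)
    (hS : ∀ u v, Seg' u v ↔ ∃ x y, u = root x ∧ v = root y ∧ Seg x y)
    (hB : ∀ u v, Bit' u v ↔ ∃ x y, u = root x ∧ v = root y ∧ Bit x y) {m m' : W}
    (h : PowRel Seg Bit m m') : PowRel Seg' Bit' (root m) (root m') := by
  have hS' : ∀ x y, Seg' (root x) (root y) ↔ Seg x y := fun x y => by
    rw [hS]
    exact ⟨fun ⟨x', y', h1, h2, h3⟩ => by rwa [hroot h1, hroot h2], fun h => ⟨x, y, rfl, rfl, h⟩⟩
  have hB' : ∀ x y, Bit' (root x) (root y) ↔ Bit x y := fun x y => by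
    rw [hB]
    exact ⟨fun ⟨x', y', h1, h2, h3⟩ => by rwa [hroot h1, hroot h2], fun h => ⟨x, y, rfl, rfl, h⟩⟩
  have hS'' : ∀ u y, Seg' u (root y) → ∃ x, u = root x ∧ Seg x y := fun u y h => by
    obtain ⟨x, y', h1, h2, h3⟩ := (hS _ _).1 h
    exact ⟨x, h1, by rwa [hroot h2]⟩
  obtain ⟨h1, ⟨x₀, hx₀, hx₀'⟩, h3⟩ := h
  refine ⟨?_, ⟨root x₀, (hS' _ _).2 hx₀, ?_⟩, ?_⟩
  · intro u v hu hv huv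
    obtain ⟨x, rfl, hx⟩ := hS'' u _ hu
    obtain ⟨x', rfl, hx'⟩ := hS'' v _ hv
    obtain ⟨y, hy, hb⟩ := h1 x x' hx hx' (fun h => huv (h ▸ rfl))
    exact ⟨root y, (hS' _ _).2 hy, by rwa [hB', hB']⟩
  · intro v hv
    obtain ⟨y, rfl, hy⟩ := hS'' v _ hv
    rw [hB']
    exact hx₀' y hy
  · intro u v hu hv
    obtain ⟨x, rfl, hx⟩ := hS'' u _ hu
    obtain ⟨y, rfl, hy⟩ := hS'' v _ hv
    obtain ⟨x', hx', hb⟩ := h3 x y hx hy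
    refine ⟨root x', (hS' _ _).2 hx', fun v' hv' => ?_⟩
    obtain ⟨y', rfl, hy'⟩ := hS'' v' _ hv'
    rw [hB', hB', hroot.eq_iff]
    exact hb y' hy'

theorem TowerCert.map {W V : Type*} {Seg Bit : W → W → Prop} {Seg' Bit' : V → V → Prop}
    {root : W → V} (hroot : Function.Injective root)
    (hS : ∀ u v, Seg' u v ↔ ∃ x y, u = root x ∧ v = root y ∧ Seg x y)
    (hB : ∀ u v, Bit' u v ↔ ∃ x y, u = root x ∧ v = root y ∧ Bit x y) {Mk : Set W}
    (h : TowerCert Seg Bit Set.univ Mk) :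
    TowerCert Seg' Bit' (Set.range root) (root '' Mk) := by
  obtain ⟨h1, t, ht, hall⟩ := h
  refine ⟨?_, root t, ⟨t, ht, rfl⟩, fun u => ⟨fun hu => ?_, ?_⟩⟩
  · rintro _ ⟨i, hi, rfl⟩
    rcases h1 i hi with h0 | ⟨m, hm, m'', hp, hp'⟩
    · left
      intro u hu
      obtain ⟨x, y, -, h2, h3⟩ := (hS _ _).1 hu
      exact h0 x (hroot h2 ▸ h3)
    · exact Or.inr ⟨root m, ⟨m, hm, rfl⟩, root m'', hp.map hroot hS hB, hp'.map hroot hS hB⟩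
  · obtain ⟨x, y, h2, -⟩ := (hS _ _).1 hu
    exact ⟨x, h2.symm⟩
  · rintro ⟨x, rfl⟩
    exact (hS _ _).2 ⟨x, t, rfl, rfl, (hall x).2 trivial⟩

/-! ### First-order definability -/

/-- The predicate `P` is definable by a first-order formula with `k` free variables. -/
def FODef (m : ℕ) [NeZero m] {k : ℕ}
    (P : ∀ n : ℕ, SimpleGraph (Fin n) → (ℕ → Set (Fin n)) → (Fin k → Fin n) → Prop) : Prop :=
  ∃ φ : (Lang m).BoundedFormula Empty k, ∀ (n : ℕ) (G : SimpleGraph (Fin n))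
    (S : Fin m → Set (Fin n)) (v : Fin k → Fin n),
    @FirstOrder.Language.BoundedFormula.Realize (Lang m) (Fin n) (structOf G S) Empty k φ
      default v ↔ P n G (fun r => S (Fin.ofNat m r)) v

namespace FODef

variable {m : ℕ} [NeZero m] {k : ℕ}
  {P Q : ∀ n : ℕ, SimpleGraph (Fin n) → (ℕ → Set (Fin n)) → (Fin k → Fin n) → Prop}

theorem adj (i l : Fin k) : FODef m (fun _ G _ v => G.Adj (v i) (v l)) := by
  refine ⟨Language.Relations.boundedFormula₂ (L := Lang m) (α := Empty) (n := k)
    (show (Lang m).Relations 2 from ())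
    (Language.Term.var (Sum.inr i)) (Language.Term.var (Sum.inr l)), fun n G S v => ?_⟩
  let _ := structOf G S
  exact Language.BoundedFormula.realize_rel₂

theorem mem (r : ℕ) (i : Fin k) : FODef m (fun _ _ F v => v i ∈ F r) := by
  refine ⟨Language.Relations.boundedFormula₁ (L := Lang m) (α := Empty) (n := k)
    (show (Lang m).Relations 1 from (Fin.ofNat m r : Fin m))
    (Language.Term.var (Sum.inr i)), fun n G S v => ?_⟩
  let _ := structOf G S
  exact Language.BoundedFormula.realize_rel₁

theorem eq (i l : Fin k) : FODef m (fun _ _ _ v => v i = v l) := by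
  refine ⟨Language.Term.bdEqual (L := Lang m) (α := Empty) (n := k)
    (Language.Term.var (Sum.inr i)) (Language.Term.var (Sum.inr l)), fun n G S v => ?_⟩
  let _ := structOf G S
  exact Language.BoundedFormula.realize_bdEqual _ _

theorem imp (hP : FODef m P) (hQ : FODef m Q) : FODef m (fun n G F v => P n G F v → Q n G F v) := by
  obtain ⟨φ, hφ⟩ := hP
  obtain ⟨ψ, hψ⟩ := hQ
  refine ⟨φ.imp ψ, fun n G S v => ?_⟩
  let _ := structOf G S
  rw [Language.BoundedFormula.realize_imp, hφ, hψ]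

theorem not (hP : FODef m P) : FODef m (fun n G F v => ¬ P n G F v) := by
  obtain ⟨φ, hφ⟩ := hP
  refine ⟨φ.not, fun n G S v => ?_⟩
  let _ := structOf G S
  rw [Language.BoundedFormula.realize_not, hφ]

theorem and (hP : FODef m P) (hQ : FODef m Q) :
    FODef m (fun n G F v => P n G F v ∧ Q n G F v) := by
  obtain ⟨φ, hφ⟩ := hP
  obtain ⟨ψ, hψ⟩ := hQ
  refine ⟨φ ⊓ ψ, fun n G S v => ?_⟩
  let _ := structOf G S
  rw [Language.BoundedFormula.realize_inf, hφ, hψ]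

theorem or (hP : FODef m P) (hQ : FODef m Q) :
    FODef m (fun n G F v => P n G F v ∨ Q n G F v) := by
  obtain ⟨φ, hφ⟩ := hP
  obtain ⟨ψ, hψ⟩ := hQ
  refine ⟨φ ⊔ ψ, fun n G S v => ?_⟩
  let _ := structOf G S
  rw [Language.BoundedFormula.realize_sup, hφ, hψ]

theorem iff (hP : FODef m P) (hQ : FODef m Q) :
    FODef m (fun n G F v => P n G F v ↔ Q n G F v) := by
  obtain ⟨φ, hφ⟩ := hP
  obtain ⟨ψ, hψ⟩ := hQ
  refine ⟨φ.iff ψ, fun n G S v => ?_⟩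
  let _ := structOf G S
  rw [Language.BoundedFormula.realize_iff, hφ, hψ]

theorem snoc_eq {n : ℕ} (v : Fin k → Fin n) (x : Fin n) :
    (fun i : Fin k => (Fin.snoc v x : Fin (k + 1) → Fin n) i.castSucc) = v :=
  funext fun _ => Fin.snoc_castSucc (α := fun _ => Fin n) _ _ _

variable {R : ∀ n : ℕ, SimpleGraph (Fin n) → (ℕ → Set (Fin n)) → (Fin k → Fin n) → Fin n → Prop}

theorem all (h : FODef m (k := k + 1)
      (fun n G F w => R n G F (fun i => w i.castSucc) (w (Fin.last k)))) :
    FODef m (fun n G F v => ∀ x, R n G F v x) := by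
  obtain ⟨φ, hφ⟩ := h
  refine ⟨φ.all, fun n G S v => ?_⟩
  let _ := structOf G S
  rw [Language.BoundedFormula.realize_all]
  refine forall_congr' fun x => ?_
  rw [hφ]
  beta_reduce
  rw [snoc_eq, Fin.snoc_last]

theorem ex (h : FODef m (k := k + 1)
      (fun n G F w => R n G F (fun i => w i.castSucc) (w (Fin.last k)))) :
    FODef m (fun n G F v => ∃ x, R n G F v x) := by
  obtain ⟨φ, hφ⟩ := h
  refine ⟨φ.ex, fun n G S v => ?_⟩
  let _ := structOf G S
  rw [Language.BoundedFormula.realize_ex]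
  refine exists_congr fun x => ?_
  rw [hφ]
  beta_reduce
  rw [snoc_eq, Fin.snoc_last]

theorem bel (j : ℕ) {k : ℕ} (i l : Fin k) : FODef m (fun _ G F v => Bel G F j (v i) (v l)) := by
  induction j generalizing k with
  | zero => exact (mem 0 i).and (eq i l)
  | succ j ih => exact (mem (j + 1) i).and (ex ((adj i.castSucc (Fin.last k)).and (ih _ _)))

theorem lk (j : ℕ) (i l : Fin k) : FODef m (fun _ G F v => Lk G F j (v i) (v l)) :=
  ex ((adj i.castSucc (Fin.last k)).and (bel j (Fin.last k) l.castSucc))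

theorem lkT (r j : ℕ) (i l : Fin k) : FODef m (fun _ G F v => LkT G F r j (v i) (v l)) :=
  ex ((adj i.castSucc (Fin.last k)).and ((mem r (Fin.last k)).and
    (ex ((adj (Fin.last k).castSucc (Fin.last (k + 1))).and
      (bel j (Fin.last (k + 1)) l.castSucc.castSucc)))))

theorem wRel (K r : ℕ) (i l : Fin k) : FODef m (fun _ G F v => WRel G F K r (v i) (v l)) :=
  ex ((mem r (Fin.last k)).and ((lk K (Fin.last k) i.castSucc).and
    (lk (K + 1) (Fin.last k) l.castSucc)))

theorem powRel {Seg Bit : ∀ n : ℕ, SimpleGraph (Fin n) → (ℕ → Set (Fin n)) → Fin n → Fin n → Prop}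
    (hS : ∀ k (i l : Fin k), FODef m (fun n G F v => Seg n G F (v i) (v l)))
    (hB : ∀ k (i l : Fin k), FODef m (fun n G F v => Bit n G F (v i) (v l))) (i l : Fin k) :
    FODef m (fun n G F v => PowRel (Seg n G F) (Bit n G F) (v i) (v l)) := by
  refine and ?_ (and ?_ ?_)
  · exact all (all (imp (hS _ _ _) (imp (hS _ _ _) (imp (not (eq _ _))
      (ex (and (hS _ _ _) (not (iff (hB _ _ _) (hB _ _ _)))))))))
  · exact ex (and (hS _ _ _) (all (imp (hS _ _ _) (not (hB _ _ _)))))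
  · exact all (all (imp (hS _ _ _) (imp (hS _ _ _) (ex (and (hS _ _ _)
      (all (imp (hS _ _ _) (iff (hB _ _ _) (or (hB _ _ _) (eq _ _))))))))))

theorem towerCert
    {Seg Bit : ∀ n : ℕ, SimpleGraph (Fin n) → (ℕ → Set (Fin n)) → Fin n → Fin n → Prop}
    (hS : ∀ k (i l : Fin k), FODef m (fun n G F v => Seg n G F (v i) (v l)))
    (hB : ∀ k (i l : Fin k), FODef m (fun n G F v => Bit n G F (v i) (v l))) (r s : ℕ) :
    FODef m (k := k) (fun n G F _ => TowerCert (Seg n G F) (Bit n G F) (F r) (F s)) := by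
  refine and ?_ ?_
  · exact all (imp (mem _ _) (or (all (not (hS _ _ _)))
      (ex (and (mem _ _) (ex (and (powRel hS hB _ _) (powRel hS hB _ _)))))))
  · exact ex (and (mem _ _) (all (iff (hS _ _ _) (mem _ _))))

theorem cert (K : ℕ) : FODef m (k := k) (fun _ G F _ => Cert G F K) := by
  refine and ?_ ?_
  · exact towerCert (fun _ => wRel K (K + 4)) (fun _ => wRel K (K + 5)) _ _
  · exact all (all (imp (not (eq _ _)) (ex (or (not (iff (lkT _ _ _ _) (lkT _ _ _ _)))
      (not (iff (lkT _ _ _ _) (lkT _ _ _ _)))))))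

end FODef

theorem Bel.congr {V : Type*} {G : SimpleGraph V} {F F' : ℕ → Set V} {j : ℕ}
    (h : ∀ i ≤ j, F i = F' i) : Bel G F j = Bel G F' j := by
  induction j with
  | zero => funext t x; simp only [Bel, h 0 le_rfl]
  | succ j ih =>
    funext t x
    simp only [Bel, h (j + 1) le_rfl, ih fun i hi => h i (hi.trans (Nat.le_succ _))]

theorem Cert.congr {V : Type*} {G : SimpleGraph V} {F F' : ℕ → Set V} {K : ℕ}
    (h : ∀ r < K + 7, F r = F' r) (hc : Cert G F K) : Cert G F' K := by
  have hB : ∀ j ≤ K + 1, Bel G F j = Bel G F' j := fun j hj =>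
    Bel.congr fun i hi => h i (by omega)
  have hW : ∀ r < K + 7, WRel G F K r = WRel G F' K r := fun r hr => by
    funext x y
    simp only [WRel, Lk, h r hr, hB K (by omega), hB (K + 1) le_rfl]
  have hT : ∀ r < K + 7, ∀ j ≤ K + 1, LkT G F r j = LkT G F' r j := fun r hr j hj => by
    funext u x
    simp only [LkT, BelT, h r hr, hB j hj]
  rw [Cert, hW _ (by omega), hW _ (by omega), hT _ (by omega) _ le_rfl,
    hT _ (by omega) _ (by omega), h 0 (by omega), h (K + 6) (by omega)] at hc
  exact hc

/-- Being certified is an existential monadic second-order property. -/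
theorem exists_sentence (K : ℕ) : ∃ φ : (Lang (K + 7)).Sentence, ∀ (n : ℕ)
    (G : SimpleGraph (Fin n)), EMSOSat G φ ↔ ∃ F : ℕ → Set (Fin n), Cert G F K := by
  obtain ⟨φ, hφ⟩ := FODef.cert (m := K + 7) (k := 0) K
  refine ⟨φ, fun n G => ⟨?_, ?_⟩⟩
  · rintro ⟨S, hS⟩
    exact ⟨_, (hφ n G S default).1 hS⟩
  · rintro ⟨F, hF⟩
    refine ⟨fun r => F r, (hφ n G _ default).2 (hF.congr fun r hr => ?_)⟩
    rw [Fin.val_ofNat, Nat.mod_eq_of_lt hr]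

/-! ### Constructing a certificate from a tree of representatives -/

section Representatives

variable {V : Type*} {a : ℕ}

/-- `u` is adjacent to one of the representatives `σ x 0, …, σ x (b - 1)`. -/
def Hit (G : SimpleGraph V) (b : ℕ) (σ : Fin a → ℕ → V) (u : V) (x : Fin a) : Prop :=
  ∃ k < b, G.Adj u (σ x k)

/-- Among the representatives, `t` is adjacent exactly to some of those of `x`. -/
def Good (G : SimpleGraph V) (b : ℕ) (σ : Fin a → ℕ → V) (x : Fin a) (t : V) : Prop :=
  ∀ y, Hit G b σ t y ↔ y = x

theorem bel_iff {G : SimpleGraph V} {F : ℕ → Set V} {b : ℕ → ℕ} {rep : ℕ → Fin a → ℕ → V} {K : ℕ}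
    (hb : b 0 = 1) (hF : ∀ j ≤ K, F j = {t | ∃ x, ∃ k < b j, t = rep j x k})
    (hgood : ∀ j < K, ∀ x, ∀ k < b (j + 1), Good G (b j) (rep j) x (rep (j + 1) x k))
    {j : ℕ} (hj : j ≤ K) (t v : V) :
    Bel G F j t v ↔ ∃ x, v = rep 0 x 0 ∧ ∃ k < b j, t = rep j x k := by
  induction j generalizing t with
  | zero =>
    simp only [Bel, hF 0 hj, hb, Set.mem_ofPred_eq, Nat.lt_one_iff, exists_eq_left]
    constructor
    · rintro ⟨⟨x, rfl⟩, rfl⟩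
      exact ⟨x, rfl, rfl⟩
    · rintro ⟨x, rfl, rfl⟩
      exact ⟨⟨x, rfl⟩, rfl⟩
  | succ j ih =>
    simp only [Bel, hF (j + 1) hj, ih (by omega), Set.mem_ofPred_eq]
    constructor
    · rintro ⟨⟨x, k, hk, rfl⟩, s, hts, y, rfl, l, hl, rfl⟩
      have := (hgood j hj x k hk y).1 ⟨l, hl, hts⟩
      exact ⟨x, by rw [this], k, hk, rfl⟩
    · rintro ⟨x, rfl, k, hk, rfl⟩
      obtain ⟨l, hl, hadj⟩ := (hgood j hj x k hk x).2 rfl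
      exact ⟨⟨x, k, hk, rfl⟩, _, hadj, x, rfl, l, hl, rfl⟩

theorem cert_of_good {G : SimpleGraph V} {b : ℕ → ℕ} {rep : ℕ → Fin a → ℕ → V} {K : ℕ}
    (hb : b 0 = 1) (hroot : Function.Injective fun x => rep 0 x 0)
    (hgood : ∀ j ≤ K + 1, ∀ x, ∀ k < b (j + 1), Good G (b j) (rep j) x (rep (j + 1) x k))
    (hgood' : ∀ x, ∀ k < b (K + 3), Good G (b K) (rep K) x (rep (K + 3) x k))
    {w w' : Fin a → Fin a → V}
    (hw : ∀ x y, Good G (b K) (rep K) x (w x y) ∧ Good G (b (K + 1)) (rep (K + 1)) y (w x y))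
    (hw' : ∀ x y, Good G (b K) (rep K) x (w' x y) ∧ Good G (b (K + 1)) (rep (K + 1)) y (w' x y))
    (hsep : ∀ u v, u ≠ v → ∃ x,
      ¬ (Hit G (b (K + 2)) (rep (K + 2)) u x ↔ Hit G (b (K + 2)) (rep (K + 2)) v x) ∨
      ¬ (Hit G (b (K + 3)) (rep (K + 3)) u x ↔ Hit G (b (K + 3)) (rep (K + 3)) v x))
    {Seg Bit : Fin a → Fin a → Prop} {Mk : Set (Fin a)}
    (htower : TowerCert Seg Bit Set.univ Mk) : ∃ F, Cert G F K := by
  set root : Fin a → V := fun x => rep 0 x 0 with hroot_def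
  set F : ℕ → Set V := fun r =>
    if r = K + 4 then {v | ∃ x y, Seg x y ∧ v = w x y}
    else if r = K + 5 then {v | ∃ x y, Bit x y ∧ v = w' x y}
    else if r = K + 6 then root '' Mk
    else {t | ∃ x, ∃ k < b r, t = rep r x k} with hF
  have hFj : ∀ j ≤ K + 3, F j = {t | ∃ x, ∃ k < b j, t = rep j x k} := fun j hj => by
    simp only [hF]
    rw [if_neg (by omega), if_neg (by omega), if_neg (by omega)]
  have hF4 : F (K + 4) = {v | ∃ x y, Seg x y ∧ v = w x y} := by simp [hF]
  have hF5 : F (K + 5) = {v | ∃ x y, Bit x y ∧ v = w' x y} := by simp [hF]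
  have hF6 : F (K + 6) = root '' Mk := by simp [hF]
  have hF0 : F 0 = Set.range root := by
    rw [hFj 0 (by omega), hb]
    ext v
    simp [hroot_def, eq_comm]
  have hbel : ∀ j ≤ K + 1, ∀ t v, Bel G F j t v ↔ ∃ x, v = root x ∧ ∃ k < b j, t = rep j x k :=
    fun j hj => bel_iff hb (fun i hi => hFj i (by omega)) (fun i hi => hgood i (by omega)) hj
  have hLk : ∀ j ≤ K + 1, ∀ u v, Lk G F j u v ↔ ∃ x, v = root x ∧ Hit G (b j) (rep j) u x := by
    intro j hj u v
    simp only [Lk, hbel j hj]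
    constructor
    · rintro ⟨_, hadj, x, hv, k, hk, rfl⟩
      exact ⟨x, hv, k, hk, hadj⟩
    · rintro ⟨x, hv, k, hk, hadj⟩
      exact ⟨_, hadj, x, hv, k, hk, rfl⟩
  have hLkT : ∀ r j, r ≤ K + 3 → j ≤ K + 1 →
      (∀ x, ∀ k < b r, Good G (b j) (rep j) x (rep r x k)) →
      ∀ u x, LkT G F r j u (root x) ↔ Hit G (b r) (rep r) u x := by
    intro r j hr hj hg u x
    simp only [LkT, BelT, hbel j hj, hFj r hr]
    constructor
    · rintro ⟨_, hadj, ⟨y, k, hk, rfl⟩, _, hadj', z, hz, l, hl, rfl⟩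
      have h1 := (hg y k hk z).1 ⟨l, hl, hadj'⟩
      have h2 := hroot hz
      exact ⟨k, hk, by rwa [h2, h1]⟩
    · rintro ⟨k, hk, hadj⟩
      obtain ⟨l, hl, hadj'⟩ := (hg x k hk x).2 rfl
      exact ⟨_, hadj, ⟨x, k, hk, rfl⟩, _, hadj', x, rfl, l, hl, rfl⟩
  have hW : ∀ r (P : Fin a → Fin a → Prop) (ω : Fin a → Fin a → V),
      F r = {v | ∃ x y, P x y ∧ v = ω x y} →
      (∀ x y, Good G (b K) (rep K) x (ω x y) ∧ Good G (b (K + 1)) (rep (K + 1)) y (ω x y)) →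
      ∀ u v, WRel G F K r u v ↔ ∃ x y, u = root x ∧ v = root y ∧ P x y := by
    intro r P ω hFr hω u v
    simp only [WRel, hLk K (by omega), hLk (K + 1) le_rfl, hFr]
    constructor
    · rintro ⟨_, ⟨x, y, hP, rfl⟩, ⟨x', hu, hx⟩, y', hv, hy⟩
      obtain rfl := ((hω x y).1 x').1 hx
      obtain rfl := ((hω x' y).2 y').1 hy
      exact ⟨x', y', hu, hv, hP⟩
    · rintro ⟨x, y, hu, hv, hP⟩
      exact ⟨_, ⟨x, y, hP, rfl⟩, ⟨x, hu, ((hω x y).1 x).2 rfl⟩, y, hv, ((hω x y).2 y).2 rfl⟩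
  refine ⟨F, ?_, fun u v huv => ?_⟩
  · rw [hF0, hF6]
    exact htower.map hroot (hW _ Seg w hF4 hw) (hW _ Bit w' hF5 hw')
  · obtain ⟨x, hx⟩ := hsep u v huv
    refine ⟨root x, ?_⟩
    rwa [hLkT _ _ (by omega) le_rfl (hgood (K + 1) le_rfl),
      hLkT _ _ (by omega) le_rfl (hgood (K + 1) le_rfl), hLkT _ _ le_rfl (by omega) hgood',
      hLkT _ _ le_rfl (by omega) hgood']

end Representatives

/-! ### Probabilities of missing representatives -/

section MissingRepresentatives

variable {n a : ℕ} {p : ℝ}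

open scoped Classical in
/-- The set of all representatives. -/
def repSet (b : ℕ) (σ : Fin a → ℕ → Fin n) : Finset (Fin n) :=
  (Finset.univ ×ˢ Finset.range b).image fun q : Fin a × ℕ => σ q.1 q.2

theorem mem_repSet {b : ℕ} {σ : Fin a → ℕ → Fin n} {t : Fin n} :
    t ∈ repSet b σ ↔ ∃ x, ∃ k < b, σ x k = t := by
  simp [repSet]

theorem card_repSet_le (b : ℕ) (σ : Fin a → ℕ → Fin n) : (repSet b σ).card ≤ a * b := by
  classical
  exact Finset.card_image_le.trans (by simp)

/-- Different indices have different representatives. -/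
def RepInj (b : ℕ) (σ : Fin a → ℕ → Fin n) : Prop :=
  ∀ x y, ∀ k < b, ∀ l < b, σ x k = σ y l → x = y ∧ k = l

theorem good_of_forall {G : SimpleGraph (Fin n)} {b : ℕ} {σ : Fin a → ℕ → Fin n}
    (hσ : RepInj b σ) {x : Fin a} {k : ℕ} (hk : k < b) {t : Fin n}
    (h : ∀ y, ∀ l < b, (G.Adj t (σ y l) ↔ σ y l = σ x k)) : Good G b σ x t := by
  intro y
  constructor
  · rintro ⟨l, hl, hadj⟩
    exact (hσ _ _ l hl k hk ((h y l hl).1 hadj)).1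
  · rintro rfl
    exact ⟨k, hk, (h y k hk).2 rfl⟩

theorem prob_no_good_le (h0 : 0 ≤ p) (h1 : p ≤ 1) {b : ℕ} {σ : Fin a → ℕ → Fin n}
    (hσ : RepInj b σ) {C : Finset (Fin n)} (hC : Disjoint C (repSet b σ))
    (hb : (a * b : ℝ) * p ≤ 1 / 2) (x : Fin a) :
    prob n p (fun G => ∀ t ∈ C, ¬ Good G b σ x t) ≤ Real.exp (-(C.card * (b * p / 2))) := by
  classical
  set 𝓕 : Finset (Finset (Fin n)) := (Finset.range b).image fun k => {σ x k} with h𝓕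
  have hcard : 𝓕.card = b := by
    rw [h𝓕, Finset.card_image_of_injOn, Finset.card_range]
    intro k hk l hl hkl
    exact (hσ x x k (by simpa using hk) l (by simpa using hl) (Finset.singleton_injective hkl)).2
  have hU : ((repSet b σ).card : ℝ) * p ≤ 1 / 2 := by
    refine le_trans ?_ hb
    gcongr
    exact_mod_cast card_repSet_le b σ
  have key := prob_no_star_le h0 h1 hC hU (k := 1) (𝓕 := 𝓕) (by
    intro F hF
    obtain ⟨k, hk, rfl⟩ := Finset.mem_image.1 hF
    rw [Finset.singleton_subset_iff, mem_repSet]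
    exact ⟨⟨x, k, by simpa using hk, rfl⟩, Finset.card_singleton _⟩)
  rw [hcard, pow_one] at key
  refine (prob_mono h0 h1 fun G h t ht => ?_).trans key
  rintro ⟨F, hF, hFt⟩
  obtain ⟨k, hk, rfl⟩ := Finset.mem_image.1 hF
  refine h t ht (good_of_forall hσ (by simpa using hk) fun y l hl => ?_)
  rw [hFt _ (mem_repSet.2 ⟨y, l, hl, rfl⟩), Finset.mem_singleton]

theorem prob_no_good_and_le (h0 : 0 ≤ p) (h1 : p ≤ 1) {b b' : ℕ} {σ σ' : Fin a → ℕ → Fin n}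
    (hσ : RepInj b σ) (hσ' : RepInj b' σ') (hd : Disjoint (repSet b σ) (repSet b' σ'))
    {C : Finset (Fin n)} (hC : Disjoint C (repSet b σ)) (hC' : Disjoint C (repSet b' σ'))
    (hb : (a * b : ℝ) * p ≤ 1 / 4) (hb' : (a * b' : ℝ) * p ≤ 1 / 4) (x y : Fin a) :
    prob n p (fun G => ∀ t ∈ C, ¬ (Good G b σ x t ∧ Good G b' σ' y t)) ≤
      Real.exp (-(C.card * (b * b' * p ^ 2 / 2))) := by
  classical
  set 𝓕 : Finset (Finset (Fin n)) :=
    (Finset.range b ×ˢ Finset.range b').image fun q => {σ x q.1, σ' y q.2} with h𝓕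
  have hne : ∀ z, ∀ k < b, ∀ z', ∀ l < b', σ z k ≠ σ' z' l := fun z k hk z' l hl h =>
    Finset.disjoint_left.1 hd (mem_repSet.2 ⟨z, k, hk, rfl⟩) (mem_repSet.2 ⟨z', l, hl, h.symm⟩)
  have hcard : 𝓕.card = b * b' := by
    rw [h𝓕, Finset.card_image_of_injOn, Finset.card_product, Finset.card_range, Finset.card_range]
    rintro ⟨k, l⟩ hkl ⟨k', l'⟩ hkl' heq
    simp only [Finset.coe_product, Finset.coe_range, Set.mem_prod, Set.mem_Iio] at hkl hkl'
    simp only at heq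
    have e1 : σ x k ∈ ({σ x k', σ' y l'} : Finset (Fin n)) := heq ▸ Finset.mem_insert_self _ _
    have e2 : σ' y l ∈ ({σ x k', σ' y l'} : Finset (Fin n)) := heq ▸ by simp
    rw [Finset.mem_insert, Finset.mem_singleton] at e1 e2
    rw [Prod.mk.injEq]
    constructor
    · rcases e1 with e1 | e1
      · exact (hσ _ _ _ hkl.1 _ hkl'.1 e1).2
      · exact absurd e1 (hne _ _ hkl.1 _ _ hkl'.2)
    · rcases e2 with e2 | e2
      · exact absurd e2.symm (hne _ _ hkl'.1 _ _ hkl.2)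
      · exact (hσ' _ _ _ hkl.2 _ hkl'.2 e2).2
  have hU : ((repSet b σ ∪ repSet b' σ').card : ℝ) * p ≤ 1 / 2 := by
    have e1 := (Finset.card_union_le (repSet b σ) (repSet b' σ')).trans
      (add_le_add (card_repSet_le b σ) (card_repSet_le b' σ'))
    have e2 : ((repSet b σ ∪ repSet b' σ').card : ℝ) ≤ a * b + a * b' := by exact_mod_cast e1
    calc _ ≤ (a * b + a * b' : ℝ) * p := by gcongr
      _ ≤ _ := by linarith
  have key := prob_no_star_le h0 h1 (Finset.disjoint_union_right.2 ⟨hC, hC'⟩) hU (k := 2)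
    (𝓕 := 𝓕) (by
      intro F hF
      obtain ⟨⟨k, l⟩, hkl, rfl⟩ := Finset.mem_image.1 hF
      simp only [Finset.mem_product, Finset.mem_range] at hkl
      refine ⟨?_, Finset.card_pair (hne _ _ hkl.1 _ _ hkl.2)⟩
      intro t ht
      rw [Finset.mem_insert, Finset.mem_singleton] at ht
      rw [Finset.mem_union, mem_repSet, mem_repSet]
      rcases ht with rfl | rfl
      · exact Or.inl ⟨x, k, hkl.1, rfl⟩
      · exact Or.inr ⟨y, l, hkl.2, rfl⟩)
  rw [hcard, Nat.cast_mul] at key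
  refine (prob_mono h0 h1 fun G h t ht => ?_).trans key
  rintro ⟨F, hF, hFt⟩
  obtain ⟨⟨k, l⟩, hkl, rfl⟩ := Finset.mem_image.1 hF
  simp only [Finset.mem_product, Finset.mem_range] at hkl
  refine h t ht ⟨good_of_forall hσ hkl.1 fun z i hi => ?_,
    good_of_forall hσ' hkl.2 fun z i hi => ?_⟩
  · rw [hFt _ (Finset.mem_union_left _ (mem_repSet.2 ⟨z, i, hi, rfl⟩)), Finset.mem_insert,
      Finset.mem_singleton, or_iff_left (hne _ _ hi _ _ hkl.2)]
  · rw [hFt _ (Finset.mem_union_right _ (mem_repSet.2 ⟨z, i, hi, rfl⟩)), Finset.mem_insert,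
      Finset.mem_singleton, or_iff_right (hne _ _ hkl.1 _ _ hi).symm]

theorem prob_hit_pattern_le (h0 : 0 ≤ p) (h1 : p ≤ 1) {b : ℕ} {σ : Fin a → ℕ → Fin n}
    (hσ : RepInj b σ) (hb : b * p ≤ 1 / 2) {u : Fin n} (hu : u ∉ repSet b σ) (τ : Fin a → Prop) :
    prob n p (fun G => ∀ x, (Hit G b σ u x ↔ τ x)) ≤ Real.exp (-(a * (b * p))) := by
  classical
  have key := prob_pattern_le h0 h1 hb (u := u) (T := fun x => (Finset.range b).image (σ x))
    (fun x hx => hu (by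
      obtain ⟨k, hk, rfl⟩ := Finset.mem_image.1 hx
      exact mem_repSet.2 ⟨x, k, by simpa using hk, rfl⟩))
    (fun x => by
      rw [Finset.card_image_of_injOn, Finset.card_range]
      intro k hk l hl hkl
      exact (hσ x x k (by simpa using hk) l (by simpa using hl) hkl).2)
    (fun x y hxy => by
      rw [Finset.disjoint_left]
      intro t ht ht'
      obtain ⟨k, hk, rfl⟩ := Finset.mem_image.1 ht
      obtain ⟨l, hl, hkl⟩ := Finset.mem_image.1 ht'
      exact hxy (hσ x y k (by simpa using hk) l (by simpa using hl) hkl.symm).1) τ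
  refine (prob_mono h0 h1 fun G h x => ?_).trans key
  rw [← h x]
  simp [Hit]

theorem hit_congr {G G' : SimpleGraph (Fin n)} {b : ℕ} {σ : Fin a → ℕ → Fin n}
    {B : Set (Sym2 (Fin n))} (hG : ∀ e ∈ B, e ∈ G.edgeSet ↔ e ∈ G'.edgeSet) {t : Fin n} {x : Fin a}
    (h : ∀ k < b, s(t, σ x k) ∈ B) : Hit G b σ t x ↔ Hit G' b σ t x :=
  exists_congr fun k => and_congr_right fun hk => hG _ (h k hk)

theorem good_congr {G G' : SimpleGraph (Fin n)} {b : ℕ} {σ : Fin a → ℕ → Fin n}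
    {B : Set (Sym2 (Fin n))} (hG : ∀ e ∈ B, e ∈ G.edgeSet ↔ e ∈ G'.edgeSet) {t : Fin n} {x : Fin a}
    (h : ∀ y, ∀ k < b, s(t, σ y k) ∈ B) : Good G b σ x t ↔ Good G' b σ x t :=
  forall_congr' fun y => iff_congr (hit_congr hG (h y)) Iff.rfl

end MissingRepresentatives

/-! ### Layouts -/

/-- A family of pairwise disjoint cells of vertices: the cells of block `i` are indexed by
`Fin a` and the numbers below `b i`, and each of them has `N i` elements. -/
structure Layout (n a R : ℕ) where
  /-- The block containing a vertex. -/
  blk : Fin n → ℕ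
  /-- The cells of a block. -/
  cell : ℕ → Fin a → ℕ → Finset (Fin n)
  /-- The number of cells per index. -/
  b : ℕ → ℕ
  /-- The size of a cell. -/
  N : ℕ → ℕ
  blk_eq : ∀ {i x k t}, t ∈ cell i x k → blk t = i
  eq_of_mem : ∀ {i x k y l t}, i < R → k < b i → l < b i → t ∈ cell i x k → t ∈ cell i y l →
    x = y ∧ k = l
  card_cell : ∀ {i x k}, i < R → k < b i → (cell i x k).card = N i
  N_pos : ∀ {i}, i < R → 0 < N i
  mul_le : ∀ {i}, i < R → a * b i ≤ n

open scoped Classical in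
/-- Choose a good vertex in each cell, if there is one. -/
def nextRep {n a : ℕ} [NeZero n] (C : Fin a → ℕ → Finset (Fin n)) (b : ℕ) (σ : Fin a → ℕ → Fin n)
    (G : SimpleGraph (Fin n)) : Fin a → ℕ → Fin n := fun x k =>
  Classical.epsilon fun t => t ∈ C x k ∧ ((∃ t' ∈ C x k, Good G b σ x t') → Good G b σ x t)

theorem nextRep_spec {n a : ℕ} [NeZero n] {C : Fin a → ℕ → Finset (Fin n)} {b : ℕ}
    {σ : Fin a → ℕ → Fin n} {G : SimpleGraph (Fin n)} {x : Fin a} {k : ℕ} (h : (C x k).Nonempty) :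
    nextRep C b σ G x k ∈ C x k ∧
      ((∃ t ∈ C x k, Good G b σ x t) → Good G b σ x (nextRep C b σ G x k)) := by
  apply Classical.epsilon_spec
    (p := fun t => t ∈ C x k ∧ ((∃ t' ∈ C x k, Good G b σ x t') → Good G b σ x t))
  by_cases hg : ∃ t ∈ C x k, Good G b σ x t
  · obtain ⟨t, ht, hgt⟩ := hg
    exact ⟨t, ht, fun _ => hgt⟩
  · exact ⟨h.choose, h.choose_spec, fun h => absurd h hg⟩

theorem nextRep_congr {n a : ℕ} [NeZero n] {C : Fin a → ℕ → Finset (Fin n)} {b : ℕ}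
    {σ : Fin a → ℕ → Fin n} {G G' : SimpleGraph (Fin n)}
    (h : ∀ x k, ∀ t ∈ C x k, Good G b σ x t ↔ Good G' b σ x t) :
    nextRep C b σ G = nextRep C b σ G' := by
  funext x k
  unfold nextRep
  congr 1
  funext t
  refine propext (and_congr_right fun ht => ?_)
  rw [h x k t ht]
  refine imp_congr (exists_congr fun t' => and_congr_right fun ht' => h x k t' ht') Iff.rfl

namespace Layout

variable {n a R : ℕ} (L : Layout n a R)

/-- The pairs of vertices between two blocks. -/
def between (i j : ℕ) : Set (Sym2 (Fin n)) := {e | Sym2.map L.blk e = s(i, j)}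

theorem mem_between {i j : ℕ} {t v : Fin n} (ht : L.blk t = i) (hv : L.blk v = j) :
    s(t, v) ∈ L.between i j := by
  simp [between, ht, hv]

/-- The representatives lie in their cells. -/
def Valid (i : ℕ) (σ : Fin a → ℕ → Fin n) : Prop := ∀ x, ∀ k < L.b i, σ x k ∈ L.cell i x k

variable {L}

theorem Valid.repInj {i : ℕ} (hi : i < R) {σ : Fin a → ℕ → Fin n} (h : L.Valid i σ) :
    RepInj (L.b i) σ := fun x y k hk l hl hkl =>
  L.eq_of_mem hi hk hl (h x k hk) (hkl ▸ h y l hl)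

theorem Valid.blk_eq {i : ℕ} {σ : Fin a → ℕ → Fin n} (h : L.Valid i σ) {t : Fin n}
    (ht : t ∈ repSet (L.b i) σ) : L.blk t = i := by
  obtain ⟨x, k, hk, rfl⟩ := mem_repSet.1 ht
  exact L.blk_eq (h x k hk)

theorem Valid.good_congr {i j : ℕ} {σ : Fin a → ℕ → Fin n} (h : L.Valid j σ)
    {G G' : SimpleGraph (Fin n)} {B : Set (Sym2 (Fin n))} (hB : L.between i j ⊆ B)
    (hG : ∀ e ∈ B, e ∈ G.edgeSet ↔ e ∈ G'.edgeSet) {x : Fin a} {t : Fin n} (ht : L.blk t = i) :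
    Good G (L.b j) σ x t ↔ Good G' (L.b j) σ x t :=
  _root_.good_congr hG fun y k hk => hB (L.mem_between ht (L.blk_eq (h y k hk)))

theorem cell_nonempty {i : ℕ} (hi : i < R) (x : Fin a) {k : ℕ} (hk : k < L.b i) :
    (L.cell i x k).Nonempty :=
  Finset.card_pos.1 ((L.card_cell hi hk).symm ▸ L.N_pos hi)

theorem depOn_good {i j : ℕ} (σ : Fin a → ℕ → Fin n) (h : L.Valid j σ) {x : Fin a} {t : Fin n}
    (ht : L.blk t = i) : DepOn (fun G => Good G (L.b j) σ x t) (L.between i j) :=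
  fun _ _ hG => propext (h.good_congr subset_rfl hG ht)

variable {p : ℝ}

theorem prob_below_le (h0 : 0 ≤ p) (h1 : p ≤ 1) {i j : ℕ} (hi : i < R) (hj : j < R) (hij : i ≠ j)
    {X : SimpleGraph (Fin n) → Fin a → ℕ → Fin n} {A : Set (Sym2 (Fin n))} (hX : DepOn X A)
    (hXv : ∀ G, L.Valid j (X G)) (hA : Disjoint A (L.between i j))
    (hb : (a * L.b j : ℝ) * p ≤ 1 / 2) {c : ℝ} (hc : c ≤ L.N i * (L.b j * p / 2)) :
    prob n p (fun G => ∃ x, ∃ k < L.b i, ∀ t ∈ L.cell i x k, ¬ Good G (L.b j) (X G) x t) ≤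
      n * Real.exp (-c) := by
  classical
  set I : Finset (Fin a × ℕ) := Finset.univ ×ˢ Finset.range (L.b i) with hI
  have hIc : (I.card : ℝ) ≤ n := by
    have := L.mul_le hi
    rw [hI, Finset.card_product, Finset.card_univ, Fintype.card_fin, Finset.card_range]
    exact_mod_cast this
  calc _ ≤ prob n p (fun G => ∃ q ∈ I, L.Valid j (X G) ∧
        ∀ t ∈ L.cell i q.1 q.2, ¬ Good G (L.b j) (X G) q.1 t) := by
        refine prob_mono h0 h1 fun G ⟨x, k, hk, h⟩ => ⟨(x, k), by simp [hI, hk], hXv G, h⟩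
    _ ≤ ∑ q ∈ I, Real.exp (-c) := by
        refine (prob_exists_le h0 h1 I _).trans (Finset.sum_le_sum fun q hq => ?_)
        have hk : q.2 < L.b i := by simpa [hI] using hq
        refine prob_comp_le h0 h1 (X := X) (R := fun σ G => L.Valid j σ ∧
          ∀ t ∈ L.cell i q.1 q.2, ¬ Good G (L.b j) σ q.1 t) hX (B := L.between i j) ?_ hA ?_
        · intro σ
          by_cases hσ : L.Valid j σ
          · simp only [hσ, true_and]
            exact DepOn.forall_mem (I := (L.cell i q.1 q.2 : Set (Fin n))) fun t ht G G' hG =>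
              congrArg Not (depOn_good σ hσ (L.blk_eq ht) G G' hG)
          · simp only [hσ, false_and]
            exact fun _ _ _ => rfl
        · intro σ
          by_cases hσ : L.Valid j σ
          · simp only [hσ, true_and]
            refine (prob_no_good_le h0 h1 (hσ.repInj hj) ?_ hb q.1).trans ?_
            · rw [Finset.disjoint_left]
              intro t ht ht'
              exact hij ((L.blk_eq ht).symm.trans (hσ.blk_eq ht'))
            · rw [L.card_cell hi hk]
              exact Real.exp_le_exp.2 (neg_le_neg hc)
          · simp only [hσ, false_and, prob_false]
            exact (Real.exp_pos _).le
    _ ≤ _ := by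
        rw [Finset.sum_const, nsmul_eq_mul]
        gcongr

theorem prob_link_le (h0 : 0 ≤ p) (h1 : p ≤ 1) {i j j' : ℕ} (hi : i < R) (hj : j < R) (hj' : j' < R)
    (hij : i ≠ j) (hij' : i ≠ j') (hjj' : j ≠ j') (hab : L.b i = a)
    {X X' : SimpleGraph (Fin n) → Fin a → ℕ → Fin n} {A : Set (Sym2 (Fin n))} (hX : DepOn X A)
    (hX' : DepOn X' A) (hXv : ∀ G, L.Valid j (X G)) (hXv' : ∀ G, L.Valid j' (X' G))
    (hA : Disjoint A (L.between i j ∪ L.between i j'))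
    (hb : (a * L.b j : ℝ) * p ≤ 1 / 4) (hb' : (a * L.b j' : ℝ) * p ≤ 1 / 4) {c : ℝ}
    (hc : c ≤ L.N i * (L.b j * L.b j' * p ^ 2 / 2)) :
    prob n p (fun G => ∃ x y : Fin a, ∀ t ∈ L.cell i x y,
      ¬ (Good G (L.b j) (X G) x t ∧ Good G (L.b j') (X' G) y t)) ≤ n * Real.exp (-c) := by
  classical
  have hIc : ((Finset.univ : Finset (Fin a × Fin a)).card : ℝ) ≤ n := by
    have := L.mul_le hi
    rw [Finset.card_univ, Fintype.card_prod, Fintype.card_fin]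
    rw [hab] at this
    exact_mod_cast this
  calc _ ≤ prob n p (fun G => ∃ q ∈ (Finset.univ : Finset (Fin a × Fin a)),
        (L.Valid j (X G) ∧ L.Valid j' (X' G)) ∧ ∀ t ∈ L.cell i q.1 q.2,
          ¬ (Good G (L.b j) (X G) q.1 t ∧ Good G (L.b j') (X' G) q.2 t)) := by
        refine prob_mono h0 h1 fun G ⟨x, y, h⟩ =>
          ⟨(x, y), Finset.mem_univ _, ⟨hXv G, hXv' G⟩, h⟩
    _ ≤ ∑ q : Fin a × Fin a, Real.exp (-c) := by
        refine (prob_exists_le h0 h1 _ _).trans (Finset.sum_le_sum fun q _ => ?_)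
        have hk : (q.2 : ℕ) < L.b i := by rw [hab]; exact q.2.2
        refine prob_comp_le h0 h1 (X := fun G => (X G, X' G)) (R := fun σ G =>
          (L.Valid j σ.1 ∧ L.Valid j' σ.2) ∧ ∀ t ∈ L.cell i q.1 q.2,
            ¬ (Good G (L.b j) σ.1 q.1 t ∧ Good G (L.b j') σ.2 q.2 t))
          (fun G G' hG => Prod.ext (hX G G' hG) (hX' G G' hG))
          (B := L.between i j ∪ L.between i j') ?_ hA ?_
        · intro σ
          by_cases hσ : L.Valid j σ.1 ∧ L.Valid j' σ.2
          · simp only [hσ, true_and]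
            refine DepOn.forall_mem (I := (L.cell i q.1 q.2 : Set (Fin n))) fun t ht G G' hG =>
              propext (not_congr (and_congr ?_ ?_))
            · exact hσ.1.good_congr Set.subset_union_left hG (L.blk_eq ht)
            · exact hσ.2.good_congr Set.subset_union_right hG (L.blk_eq ht)
          · simp only [hσ, false_and]
            exact fun _ _ _ => rfl
        · intro σ
          by_cases hσ : L.Valid j σ.1 ∧ L.Valid j' σ.2
          · simp only [hσ, true_and]
            refine (prob_no_good_and_le h0 h1 (hσ.1.repInj hj) (hσ.2.repInj hj') ?_ ?_ ?_ hb hb'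
              q.1 q.2).trans ?_
            · rw [Finset.disjoint_left]
              intro t ht ht'
              exact hjj' ((hσ.1.blk_eq ht).symm.trans (hσ.2.blk_eq ht'))
            · rw [Finset.disjoint_left]
              intro t ht ht'
              exact hij ((L.blk_eq ht).symm.trans (hσ.1.blk_eq ht'))
            · rw [Finset.disjoint_left]
              intro t ht ht'
              exact hij' ((L.blk_eq ht).symm.trans (hσ.2.blk_eq ht'))
            · rw [L.card_cell hi hk]
              exact Real.exp_le_exp.2 (neg_le_neg hc)
          · simp only [hσ, false_and, prob_false]
            exact (Real.exp_pos _).le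
    _ ≤ _ := by
        rw [Finset.sum_const, nsmul_eq_mul]
        gcongr

theorem prob_same_code_le (h0 : 0 ≤ p) (h1 : p ≤ 1) {r : ℕ} (hr : r < R)
    {X : SimpleGraph (Fin n) → Fin a → ℕ → Fin n} {A : Set (Sym2 (Fin n))} (hX : DepOn X A)
    (hXv : ∀ G, L.Valid r (X G)) {u v : Fin n} (huv : u ≠ v) (hu : L.blk u ≠ r)
    (hA : ∀ t, L.blk t = r → s(u, t) ∉ A)
    (hb : L.b r * p ≤ 1 / 2) {c : ℝ} (hc : c ≤ a * (L.b r * p)) :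
    prob n p (fun G => ∀ x, Hit G (L.b r) (X G) u x ↔ Hit G (L.b r) (X G) v x) ≤
      Real.exp (-c) := by
  have key := prob_comp_le h0 h1 (ε := Real.exp (-c))
    (X := fun G => (X G, fun x => Hit G (L.b r) (X G) v x))
    (R := fun σ G => L.Valid r σ.1 ∧ ∀ x, Hit G (L.b r) σ.1 u x ↔ σ.2 x)
    (A := A ∪ {e | v ∈ e ∧ u ∉ e}) (B := {e | ∃ t, L.blk t = r ∧ e = s(u, t)}) ?_ ?_ ?_ ?_
  · exact (prob_mono h0 h1 fun G h => ⟨hXv G, h⟩).trans key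
  · intro G G' hG
    have e1 : X G = X G' := hX G G' fun e he => hG e (Or.inl he)
    simp only [e1, Prod.mk.injEq, true_and]
    funext x
    refine propext (hit_congr hG fun k hk => Or.inr ⟨by simp, ?_⟩)
    rw [Sym2.mem_iff]
    rintro (h | h)
    · exact huv h
    · exact hu (h ▸ L.blk_eq (hXv G' x k hk))
  · intro σ G G' hG
    refine propext (and_congr_right fun hσ => forall_congr' fun x => iff_congr ?_ Iff.rfl)
    exact hit_congr hG fun k hk => ⟨_, L.blk_eq (hσ x k hk), rfl⟩
  · rw [Set.disjoint_left]
    rintro e he ⟨t, ht, rfl⟩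
    rcases he with he | ⟨-, he⟩
    · exact hA t ht he
    · exact he (Sym2.mem_mk_left _ _)
  · intro σ
    by_cases hσ : L.Valid r σ.1
    · simp only [hσ, true_and]
      refine (prob_hit_pattern_le h0 h1 (hσ.repInj hr) hb (fun h => hu (hσ.blk_eq h)) σ.2).trans ?_
      exact Real.exp_le_exp.2 (neg_le_neg hc)
    · simp only [hσ, false_and, prob_false]
      exact (Real.exp_pos _).le

variable (L) [NeZero n]

/-- The representatives of the `i`-th level hanging below `σ`. -/
def below (i j : ℕ) (σ : Fin a → ℕ → Fin n) (G : SimpleGraph (Fin n)) : Fin a → ℕ → Fin n :=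
  nextRep (L.cell i) (L.b j) σ G

/-- The representatives of the levels of the tree. -/
def lev (G : SimpleGraph (Fin n)) : ℕ → Fin a → ℕ → Fin n
  | 0 => fun x k => Classical.epsilon fun t => t ∈ L.cell 0 x k
  | j + 1 => L.below (j + 1) j (lev G j) G

variable {L}

theorem valid_below {i j : ℕ} (hi : i < R) (σ : Fin a → ℕ → Fin n) (G : SimpleGraph (Fin n)) :
    L.Valid i (L.below i j σ G) := fun x _ hk => (nextRep_spec (cell_nonempty hi x hk)).1

theorem valid_lev {j : ℕ} (hj : j < R) (G : SimpleGraph (Fin n)) : L.Valid j (L.lev G j) := by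
  cases j with
  | zero => exact fun x k hk => Classical.epsilon_spec (cell_nonempty hj x hk)
  | succ j => exact valid_below hj _ G

theorem depOn_below {i j : ℕ} {X : SimpleGraph (Fin n) → Fin a → ℕ → Fin n}
    {A : Set (Sym2 (Fin n))} (hX : DepOn X A) (hXv : ∀ G, L.Valid j (X G)) :
    DepOn (fun G => L.below i j (X G) G) (A ∪ L.between i j) := by
  intro G G' hG
  simp only
  rw [hX G G' fun e he => hG e (Or.inl he)]
  exact nextRep_congr fun x k t ht =>
    (hXv G').good_congr Set.subset_union_right hG (L.blk_eq ht)

variable (L) in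
/-- The pairs of vertices between consecutive blocks, up to block `j`. -/
def chain (j : ℕ) : Set (Sym2 (Fin n)) := {e | ∃ i < j, e ∈ L.between (i + 1) i}

theorem depOn_lev {j : ℕ} (hj : j < R) : DepOn (fun G => L.lev G j) (L.chain j) := by
  induction j with
  | zero => exact fun _ _ _ => rfl
  | succ j ih =>
    refine (depOn_below (i := j + 1) (ih (by omega)) fun G => valid_lev (by omega) G).mono ?_
    rintro e (⟨i, hi, he⟩ | he)
    · exact ⟨i, by omega, he⟩
    · exact ⟨j, by omega, he⟩

end Layout

open Layout in
theorem Layout.prob_cert_ge {n a K : ℕ} [NeZero n] (L : Layout n a (K + 6)) {p c : ℝ} (h0 : 0 ≤ p)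
    (h1 : p ≤ 1) (hb : L.b 0 = 1) (hbW : ∀ r, r = K + 4 ∨ r = K + 5 → L.b r = a)
    (hU : ∀ j ≤ K + 1, (a * L.b j : ℝ) * p ≤ 1 / 4)
    (hT : ∀ r, r = K + 2 ∨ r = K + 3 → L.b r * p ≤ 1 / 2 ∧ c ≤ a * (L.b r * p))
    (hstep : ∀ j ≤ K + 1, c ≤ L.N (j + 1) * (L.b j * p / 2))
    (hstep' : c ≤ L.N (K + 3) * (L.b K * p / 2))
    (hlink : ∀ r, r = K + 4 ∨ r = K + 5 → c ≤ L.N r * (L.b K * L.b (K + 1) * p ^ 2 / 2))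
    {Seg Bit : Fin a → Fin a → Prop} {Mk : Set (Fin a)}
    (htower : TowerCert Seg Bit Set.univ Mk) :
    1 - (K + 6) * n ^ 2 * Real.exp (-c) ≤ prob n p (fun G => ∃ F, Cert G F K) := by
  classical
  have hn : (1 : ℝ) ≤ n := by exact_mod_cast NeZero.one_le
  have hbet : ∀ {i j i' j' : ℕ}, s(i, j) ≠ s(i', j') → Disjoint (L.between i j) (L.between i' j') :=
    fun h => Set.disjoint_left.2 fun e he he' => h (he.symm.trans he')
  have hchain : ∀ {j i i' : ℕ}, (∀ l < j, s(l + 1, l) ≠ s(i, i')) →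
      Disjoint (L.chain j) (L.between i i') := fun h =>
    Set.disjoint_left.2 fun e ⟨l, hl, he⟩ he' => h l hl (he.symm.trans he')
  have hX : ∀ j < K + 6, DepOn (fun G => L.lev G j) (L.chain j) := fun j hj => depOn_lev hj
  have hXv : ∀ j < K + 6, ∀ G, L.Valid j (L.lev G j) := fun j hj G => valid_lev hj G
  have hU' : ∀ j ≤ K + 1, (a * L.b j : ℝ) * p ≤ 1 / 2 := fun j hj => (hU j hj).trans (by norm_num)
  set low : SimpleGraph (Fin n) → Fin a → ℕ → Fin n :=
    fun G => L.below (K + 3) K (L.lev G K) G with hlow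
  have hlow_dep : DepOn low (L.chain K ∪ L.between (K + 3) K) :=
    depOn_below (hX K (by omega)) (hXv K (by omega))
  have hlow_valid : ∀ G, L.Valid (K + 3) (low G) := fun G => valid_below (by omega) _ G
  set bad₁ : SimpleGraph (Fin n) → Prop := fun G => ∃ j ∈ Finset.range (K + 2), ∃ x,
    ∃ k < L.b (j + 1), ∀ t ∈ L.cell (j + 1) x k, ¬ Good G (L.b j) (L.lev G j) x t with hbad₁
  set bad₂ : SimpleGraph (Fin n) → Prop := fun G => ∃ x,
    ∃ k < L.b (K + 3), ∀ t ∈ L.cell (K + 3) x k, ¬ Good G (L.b K) (L.lev G K) x t with hbad₂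
  set bad₃ : ℕ → SimpleGraph (Fin n) → Prop := fun r G => ∃ x y : Fin a, ∀ t ∈ L.cell r x y,
    ¬ (Good G (L.b K) (L.lev G K) x t ∧ Good G (L.b (K + 1)) (L.lev G (K + 1)) y t) with hbad₃
  set bad₄ : SimpleGraph (Fin n) → Prop := fun G =>
    ∃ q ∈ (Finset.univ : Finset (Fin n × Fin n)), q.1 ≠ q.2 ∧
      (∀ x, Hit G (L.b (K + 2)) (L.lev G (K + 2)) q.1 x ↔
        Hit G (L.b (K + 2)) (L.lev G (K + 2)) q.2 x) ∧
      ∀ x, Hit G (L.b (K + 3)) (low G) q.1 x ↔ Hit G (L.b (K + 3)) (low G) q.2 x with hbad₄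
  have hp₁ : prob n p bad₁ ≤ (K + 2) * (n * Real.exp (-c)) := by
    refine (prob_exists_le h0 h1 _ _).trans ((Finset.sum_le_sum fun j hj => ?_).trans_eq
      (b := ∑ _j ∈ Finset.range (K + 2), n * Real.exp (-c)) (by simp))
    rw [Finset.mem_range] at hj
    refine prob_below_le h0 h1 (by omega) (by omega) (by omega) (hX j (by omega))
      (hXv j (by omega)) (hchain fun l hl h => ?_) (hU' j (by omega)) (hstep j (by omega))
    rw [Sym2.eq_iff] at h
    omega
  have hp₂ : prob n p bad₂ ≤ n * Real.exp (-c) := by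
    refine prob_below_le h0 h1 (by omega) (by omega) (by omega) (hX K (by omega))
      (hXv K (by omega)) (hchain fun l hl h => ?_) (hU' K (by omega)) hstep'
    rw [Sym2.eq_iff] at h
    omega
  have hp₃ : ∀ r, r = K + 4 ∨ r = K + 5 → prob n p (bad₃ r) ≤ n * Real.exp (-c) := by
    intro r hr
    refine prob_link_le (A := L.chain (K + 1)) h0 h1 (by omega) (by omega) (by omega) (by omega) (by omega) (by omega)
      (hbW r hr) ((hX K (by omega)).mono fun e ⟨l, hl, he⟩ => ⟨l, by omega, he⟩)
      (hX (K + 1) (by omega)) (hXv K (by omega)) (hXv (K + 1) (by omega)) ?_ (hU K (by omega))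
      (hU _ le_rfl) (hlink r hr)
    refine Set.disjoint_union_right.2 ⟨hchain fun l hl h => ?_, hchain fun l hl h => ?_⟩
    all_goals
      rw [Sym2.eq_iff] at h
      omega
  have hp₄ : prob n p bad₄ ≤ n ^ 2 * Real.exp (-c) := by
    refine (prob_exists_le h0 h1 _ _).trans ((Finset.sum_le_sum fun q hq => ?_).trans_eq
      (b := ∑ _q : Fin n × Fin n, Real.exp (-c)) (by simp [sq]))
    by_cases hq : q.1 = q.2
    · simp only [hq, ne_eq, not_true_eq_false, false_and, prob_false]
      exact (Real.exp_pos _).le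
    by_cases hu : L.blk q.1 = K + 1 ∨ L.blk q.1 = K + 2
    · refine (prob_mono h0 h1 fun G h => h.2.2).trans (prob_same_code_le h0 h1 (by omega) hlow_dep
        hlow_valid hq (by omega) (fun t ht => ?_) (hT _ (Or.inr rfl)).1 (hT _ (Or.inr rfl)).2)
      rintro (⟨l, hl, h⟩ | h)
      all_goals
        simp only [between, Set.mem_ofPred_eq, Sym2.map_mk, ht, Sym2.eq_iff] at h
        omega
    · refine (prob_mono h0 h1 fun G h => h.2.1).trans (prob_same_code_le h0 h1 (by omega)
        (hX (K + 2) (by omega)) (hXv (K + 2) (by omega)) hq (by omega) (fun t ht => ?_)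
        (hT _ (Or.inl rfl)).1 (hT _ (Or.inl rfl)).2)
      rintro ⟨l, hl, h⟩
      simp only [between, Set.mem_ofPred_eq, Sym2.map_mk, ht, Sym2.eq_iff] at h
      omega
  have hcert : ∀ G, ¬ (∃ F, Cert G F K) →
      (bad₁ G ∨ bad₂ G) ∨ (bad₃ (K + 4) G ∨ bad₃ (K + 5) G) ∨ bad₄ G := by
    intro G hG
    by_contra! hcon
    obtain ⟨⟨g₁, g₂⟩, ⟨g₃, g₃'⟩, g₄⟩ := hcon
    simp only [hbad₁, hbad₂, hbad₃, hbad₄] at g₁ g₂ g₃ g₃' g₄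
    push Not at g₁ g₂ g₃ g₃'
    choose w hw using g₃
    choose w' hw' using g₃'
    refine hG (cert_of_good (b := L.b) (rep := fun i => if i = K + 3 then low G else L.lev G i)
      (w := w) (w' := w') hb ?_ ?_ ?_ ?_ ?_ ?_ htower)
    · intro x y hxy
      simp only [show (0 : ℕ) ≠ K + 3 by omega, if_false] at hxy
      have hv := hXv 0 (by omega) G
      exact (hv.repInj (by omega) x y 0 (by omega) 0 (by omega) hxy).1
    · intro j hj x k hk
      simp only [show j ≠ K + 3 by omega, show j + 1 ≠ K + 3 by omega, if_false]
      exact (nextRep_spec (cell_nonempty (by omega) x hk)).2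
        (g₁ j (Finset.mem_range.2 (by omega)) x k hk)
    · intro x k hk
      simp only [show K ≠ K + 3 by omega, if_false, if_true]
      exact (nextRep_spec (cell_nonempty (by omega) x hk)).2 (g₂ x k hk)
    · intro x y
      simp only [show K ≠ K + 3 by omega, show K + 1 ≠ K + 3 by omega, if_false]
      exact (hw x y).2
    · intro x y
      simp only [show K ≠ K + 3 by omega, show K + 1 ≠ K + 3 by omega, if_false]
      exact (hw' x y).2
    · intro u v huv
      simp only [show K + 2 ≠ K + 3 by omega, if_false, if_true]
      by_contra! hall
      exact g₄ ⟨(u, v), Finset.mem_univ _, huv, fun x => (hall x).1, fun x => (hall x).2⟩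
  have htot : prob n p (fun G => ¬ ∃ F, Cert G F K) ≤ (K + 6) * n ^ 2 * Real.exp (-c) := by
    refine (prob_mono h0 h1 hcert).trans ((prob_or_le h0 h1 _ _).trans
      ((add_le_add (prob_or_le h0 h1 _ _) ((prob_or_le h0 h1 _ _).trans
        (add_le_add_left (prob_or_le h0 h1 _ _) _))).trans ?_))
    have e3 := hp₃ _ (Or.inl rfl)
    have e4 := hp₃ _ (Or.inr rfl)
    have e5 : (n : ℝ) * Real.exp (-c) ≤ n ^ 2 * Real.exp (-c) := by
      gcongr
      nlinarith
    have e6 : (K : ℝ) * (n * Real.exp (-c)) ≤ K * (n ^ 2 * Real.exp (-c)) := by gcongr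
    linarith
  rw [prob_not] at htot
  linarith

/-- Consecutive intervals as cells. -/
def intervalLayout {n a R M : ℕ} (b N : ℕ → ℕ) (hN : ∀ i < R, 0 < N i)
    (hM : ∀ i < R, a * b i * N i ≤ M) (hn : R * M ≤ n) : Layout n a R where
  blk v := v / M
  cell i x k := Finset.univ.filter fun v : Fin n => (v : ℕ) / M = i ∧
    i * M + (x * b i + k) * N i ≤ v ∧ (v : ℕ) < i * M + (x * b i + k) * N i + N i
  b := b
  N := N
  blk_eq h := by
    rw [Finset.mem_filter] at h
    exact h.2.1
  eq_of_mem {i x k y l v} hi hk hl h h' := by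
    rw [Finset.mem_filter] at h h'
    have hq : ∀ q : ℕ, i * M + q * N i ≤ v → (v : ℕ) < i * M + q * N i + N i →
        ((v : ℕ) - i * M) / N i = q := fun q h1 h2 => by
      rw [Nat.div_eq_iff (hN i hi)]
      omega
    have e := (hq _ h.2.2.1 h.2.2.2).symm.trans (hq _ h'.2.2.1 h'.2.2.2)
    have hdiv : ∀ (x : Fin a) (k : ℕ), k < b i → (x * b i + k) / b i = x := fun x k hk => by
      rw [Nat.mul_comm, Nat.mul_add_div (by omega), Nat.div_eq_of_lt hk, add_zero]
    have hmod : ∀ (x : Fin a) (k : ℕ), k < b i → (x * b i + k) % b i = k := fun x k hk => by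
      rw [Nat.mul_comm, Nat.mul_add_mod, Nat.mod_eq_of_lt hk]
    refine ⟨Fin.ext ?_, ?_⟩
    · rw [← hdiv x k hk, ← hdiv y l hl, e]
    · rw [← hmod x k hk, ← hmod y l hl, e]
  card_cell {i x k} hi hk := by
    have h1 : (x * b i + k + 1) * N i ≤ M := by
      refine le_trans (Nat.mul_le_mul_right _ ?_) (hM i hi)
      calc x * b i + k + 1 ≤ (x + 1) * b i := by rw [Nat.add_mul]; omega
        _ ≤ a * b i := Nat.mul_le_mul_right _ x.2
    have h2 : (i + 1) * M ≤ n := (Nat.mul_le_mul_right _ hi).trans hn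
    rw [Nat.add_mul, Nat.one_mul] at h1 h2
    have h3 : (Finset.univ.filter fun v : Fin n => (v : ℕ) / M = i ∧
        i * M + (x * b i + k) * N i ≤ v ∧ (v : ℕ) < i * M + (x * b i + k) * N i + N i).map
          Fin.valEmbedding = Finset.Ico (i * M + (x * b i + k) * N i)
            (i * M + (x * b i + k) * N i + N i) := by
      ext v
      simp only [Finset.mem_map, Finset.mem_filter, Finset.mem_univ, true_and,
        Fin.valEmbedding_apply, Finset.mem_Ico]
      constructor
      · rintro ⟨v, h, rfl⟩
        exact h.2
      · intro h
        refine ⟨⟨v, by omega⟩, ⟨?_, h⟩, rfl⟩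
        rw [Nat.div_eq_iff (by have := hN i hi; omega)]
        simp only
        omega
    rw [← Finset.card_map Fin.valEmbedding, h3, Nat.card_Ico]
    omega
  N_pos {i} hi := hN i hi
  mul_le {i} hi := by
    have h1 := Nat.le_mul_of_pos_right (a * b i) (hN i hi)
    have h2 := Nat.le_mul_of_pos_left M (show 0 < R by omega)
    exact h1.trans ((hM i hi).trans (h2.trans hn))

theorem prob_cert_pow_ge {z h e K : ℕ} (hK : 1 ≤ K) (hz : K + 6 ≤ z) (hh : e + e / K + 18 ≤ h)
    (hh' : 24 ≤ h) {p : ℝ} (hp : p * z ^ (e + 6) ≤ 1) (hp' : 1 ≤ p * z ^ (e + 7))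
    {Seg Bit : Fin (z ^ 4) → Fin (z ^ 4) → Prop} {Mk : Set (Fin (z ^ 4))}
    (htower : TowerCert Seg Bit Set.univ Mk) :
    1 - (K + 6) * ((z ^ h : ℕ) : ℝ) ^ 2 * Real.exp (-(z / 2)) ≤
      prob (z ^ h) p (fun G => ∃ F, Cert G F K) := by
  have hz0 : 0 < z := by omega
  have : NeZero (z ^ h) := ⟨(pow_pos hz0 h).ne'⟩
  have hzr : (4 : ℝ) ≤ z := by exact_mod_cast (show 4 ≤ z by omega)
  have h0 : 0 ≤ p := by
    by_contra! hneg
    have : 0 < (z : ℝ) ^ (e + 7) := by positivity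
    nlinarith
  have hge : ∀ m, p * z ^ (e + 7 + m) ≥ z ^ m := fun m => by
    rw [pow_add, ← mul_assoc]
    exact le_mul_of_one_le_left (by positivity) hp'
  have h1 : p ≤ 1 := by
    refine le_trans (le_mul_of_one_le_right h0 ?_) hp
    exact one_le_pow₀ (by linarith)
  have hh2 : e + 18 ≤ h := by
    generalize e / K = q at hh
    omega
  set d : ℕ → ℕ := fun i => if i ≤ K + 1 then min ((e / K + 5) * i) e
    else if i ≤ K + 3 then e + 5 else 4 with hd
  have hd1 : ∀ i ≤ K + 1, d i ≤ e := fun i hi => by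
    simp only [hd, hi, if_true]
    exact min_le_right _ _
  have hd2 : ∀ i, K ≤ i → i ≤ K + 1 → d i = e := fun i hi hi' => by
    simp only [hd, hi', if_true]
    apply min_eq_right
    have e1 := Nat.mul_le_mul_left (e / K + 5) hi
    have e2 := Nat.div_add_mod e K
    have e3 := Nat.mod_lt e hK
    rw [Nat.add_mul, Nat.mul_comm (e / K)] at e1
    omega
  have hd3 : ∀ i, i = K + 2 ∨ i = K + 3 → d i = e + 5 := fun i hi => by
    simp only [hd]
    rw [if_neg (by omega), if_pos (by omega)]
  have hd4 : ∀ i, i = K + 4 ∨ i = K + 5 → d i = 4 := fun i hi => by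
    simp only [hd]
    rw [if_neg (by omega), if_neg (by omega)]
  have hd5 : ∀ i ≤ K, d (i + 1) ≤ d i + (e / K + 5) := fun i hi => by
    simp only [hd]
    rw [if_pos (by omega), if_pos (by omega), Nat.mul_add, Nat.mul_one]
    generalize (e / K + 5) * i = q
    generalize e / K + 5 = q'
    omega
  have hd6 : ∀ i, d i ≤ e + 5 := fun i => by
    simp only [hd]
    split_ifs <;> omega
  set L : Layout (z ^ h) (z ^ 4) (K + 6) := intervalLayout (M := z ^ (h - 1)) (fun i => z ^ d i)
    (fun i => z ^ (h - 5 - d i)) (fun i _ => pow_pos hz0 _)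
    (fun i _ => by
      have := hd6 i
      rw [← pow_add, ← pow_add]
      exact Nat.pow_le_pow_right hz0 (by omega))
    (by
      calc (K + 6) * z ^ (h - 1) ≤ z * z ^ (h - 1) := Nat.mul_le_mul_right _ hz
        _ = z ^ h := by rw [← pow_succ', Nat.sub_add_cancel (by omega)]) with hL
  have hLb : ∀ i, ((L.b i : ℕ) : ℝ) = (z : ℝ) ^ d i := fun i => by
    rw [hL]; exact Nat.cast_pow _ _
  have hLN : ∀ i, ((L.N i : ℕ) : ℝ) = (z : ℝ) ^ (h - 5 - d i) := fun i => by
    rw [hL]; exact Nat.cast_pow _ _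
  have hz1 : (1 : ℝ) ≤ z := by linarith
  have hstep : ∀ i j, e + 8 ≤ h - 5 - d i + d j → (z : ℝ) / 2 ≤ L.N i * (L.b j * p / 2) := by
    intro i j hij
    have : (z : ℝ) ^ 1 ≤ p * z ^ (h - 5 - d i + d j) :=
      (hge 1).le.trans
        (mul_le_mul_of_nonneg_left (pow_le_pow_right₀ hz1 (by omega)) h0)
    rw [hLN, hLb]
    rw [pow_one, pow_add] at this
    linarith
  refine L.prob_cert_ge (c := z / 2) h0 h1 ?_ ?_ ?_ ?_ ?_ ?_ ?_ htower
  · show z ^ d 0 = 1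
    simp [hd]
  · intro r hr
    show z ^ d r = z ^ 4
    rw [hd4 r hr]
  · intro j hj
    rw [hLb, Nat.cast_pow, ← pow_add]
    have e1 : (z : ℝ) ^ (4 + d j) ≤ z ^ (e + 4) :=
      pow_le_pow_right₀ hz1 (by have := hd1 j hj; omega)
    have e2 := hp
    rw [show e + 6 = (e + 4) + 2 by omega, pow_add] at e2
    have e3 : 0 ≤ (z : ℝ) ^ (e + 4) * p := by positivity
    have e4 : (z : ℝ) ^ (4 + d j) * p ≤ z ^ (e + 4) * p := by gcongr
    nlinarith
  · intro r hr
    rw [hLb, hd3 r hr, Nat.cast_pow]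
    constructor
    · have e2 := hp
      rw [show e + 6 = (e + 5) + 1 by omega, pow_add] at e2
      have e3 : 0 ≤ (z : ℝ) ^ (e + 5) * p := by positivity
      nlinarith
    · have := hge 2
      rw [show e + 7 + 2 = 4 + (e + 5) by omega, pow_add (z : ℝ) 4] at this
      nlinarith
  · intro j hj
    refine hstep _ _ ?_
    rcases hj.lt_or_eq with hj' | rfl
    · have := hd5 j (by omega)
      have := hd1 (j + 1) (by omega)
      omega
    · rw [hd3 (K + 1 + 1) (Or.inl rfl), hd2 (K + 1) (by omega) le_rfl]
      omega
  · refine hstep _ _ ?_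
    rw [hd3 (K + 3) (Or.inr rfl), hd2 K le_rfl (by omega)]
    omega
  · intro r hr
    rw [hLN, hLb, hLb, hd4 r hr, hd2 K le_rfl (by omega), hd2 (K + 1) (by omega) le_rfl]
    have e1 : (1 : ℝ) ≤ (p * z ^ (e + 7)) ^ 2 := one_le_pow₀ hp'
    have e2 : (z : ℝ) ^ (h - 5 - 4) = z ^ (h - 5 - 4 - 15) * z ^ 15 := by
      rw [← pow_add]; congr 1; omega
    have e3 : (1 : ℝ) ≤ z ^ (h - 5 - 4 - 15) := one_le_pow₀ hz1
    have e4 : (z : ℝ) ^ (h - 5 - 4) * (z ^ e * z ^ e * p ^ 2 / 2) =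
        z ^ (h - 5 - 4 - 15) * ((p * z ^ (e + 7)) ^ 2 * (z / 2)) := by
      rw [e2]; ring
    rw [e4]
    have e5 : (z : ℝ) / 2 ≤ (p * z ^ (e + 7)) ^ 2 * (z / 2) :=
      le_mul_of_one_le_left (by linarith) e1
    exact e5.trans (le_mul_of_one_le_left (by positivity) e3)

theorem exists_pow_four_eq_tow (i : ℕ) : ∃ z : ℕ, i ≤ z ∧ z ^ 4 = tow (i + 2) := by
  have h1 : 2 ≤ tow (i + 1) := by
    have : 1 ≤ 2 ^ tow i := Nat.one_le_two_pow
    calc 2 = 2 ^ 1 := rfl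
      _ ≤ 2 ^ 2 ^ tow i := Nat.pow_le_pow_right (by norm_num) this
  have h2 : i + 1 ≤ tow (i + 1) := tow_strictMono.le_apply
  refine ⟨2 ^ 2 ^ (tow (i + 1) - 2), ?_, ?_⟩
  · have h3 : tow (i + 1) - 2 < 2 ^ (tow (i + 1) - 2) := Nat.lt_two_pow_self
    have h4 : 2 ^ (tow (i + 1) - 2) < 2 ^ 2 ^ (tow (i + 1) - 2) := Nat.lt_two_pow_self
    omega
  · show _ = 2 ^ 2 ^ tow (i + 1)
    rw [← pow_mul]
    congr 1
    conv_rhs => rw [← Nat.sub_add_cancel h1]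
    rw [pow_add]; rfl

/-- An exponent `h` for which `prob_cert_pow_ge` applies on `z ^ h` vertices with
edge probability `z ^ (-h * α)`. -/
theorem exists_exponents {δ α : ℝ} (hδ : 0 < δ) (h0 : 0 < α) (h1 : α < 1 - δ) {K : ℕ}
    (hK : 2 / δ ≤ K) : ∃ h e : ℕ, e + e / K + 18 ≤ h ∧ 24 ≤ h ∧
      (e : ℝ) + 6 ≤ h * α ∧ h * α ≤ e + 7 := by
  obtain ⟨h, hh⟩ := exists_nat_ge (24 + 24 / δ + 7 / α)
  have hd : 0 < 24 / δ := by positivity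
  have ha : 0 < 7 / α := by positivity
  have hα : 7 ≤ h * α := (div_le_iff₀ h0).1 (by linarith)
  have hhδ : 24 ≤ h * δ := (div_le_iff₀ hδ).1 (by linarith)
  have hf : 7 ≤ ⌊h * α⌋₊ := Nat.le_floor (by exact_mod_cast hα)
  have hf1 : (⌊h * α⌋₊ : ℝ) ≤ h * α := Nat.floor_le (by positivity)
  have hf2 : h * α < ⌊h * α⌋₊ + 1 := Nat.lt_floor_add_one _
  refine ⟨h, ⌊h * α⌋₊ - 6, ?_, ?_, ?_, ?_⟩
  · have he : ((⌊h * α⌋₊ - 6 : ℕ) : ℝ) = ⌊h * α⌋₊ - 6 := by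
      rw [Nat.cast_sub (by omega)]; norm_num
    have hK0 : (0 : ℝ) < K := lt_of_lt_of_le (by positivity) hK
    have hq : (((⌊h * α⌋₊ - 6) / K : ℕ) : ℝ) ≤ h * (δ / 2) := by
      refine Nat.cast_div_le.trans ?_
      rw [div_le_iff₀ hK0, he]
      have : 1 ≤ δ / 2 * K := by
        rw [div_le_iff₀ hδ] at hK
        linarith
      have hh0 : (0 : ℝ) ≤ h := Nat.cast_nonneg h
      nlinarith
    have hm : h * α ≤ h * (1 - δ) := by gcongr
    have : ((⌊h * α⌋₊ - 6 + (⌊h * α⌋₊ - 6) / K + 18 : ℕ) : ℝ) ≤ h := by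
      rw [Nat.cast_add, Nat.cast_add, he]
      push_cast at hq ⊢
      linarith
    exact_mod_cast this
  · exact_mod_cast (show (24 : ℝ) ≤ h by linarith)
  · rw [Nat.cast_sub (by omega)]; push_cast; linarith
  · rw [Nat.cast_sub (by omega)]; push_cast; linarith

theorem tendsto_cert_error (K h : ℕ) :
    Tendsto (fun z : ℕ => 1 - (K + 6) * ((z ^ h : ℕ) : ℝ) ^ 2 * Real.exp (-(z / 2 : ℝ)))
      atTop (nhds 1) := by
  have h1 := (Real.tendsto_pow_mul_exp_neg_atTop_nhds_zero (h * 2)).comp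
    (tendsto_natCast_atTop_atTop.atTop_div_const (show (0 : ℝ) < 2 by norm_num))
  have h2 := (h1.const_mul ((K + 6) * 2 ^ (h * 2) : ℝ)).const_sub 1
  rw [mul_zero, sub_zero] at h2
  refine h2.congr fun z => ?_
  simp only [Function.comp_apply]
  rw [div_pow, Nat.cast_pow, ← pow_mul]
  field_simp

theorem rpow_neg_mul_pow {z h : ℕ} (hz : 0 < z) (α : ℝ) (m : ℕ) :
    ((z ^ h : ℕ) : ℝ) ^ (-α) * z ^ m = (z : ℝ) ^ (m - h * α) := by
  have hz' : (0 : ℝ) < z := by exact_mod_cast hz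
  rw [Nat.cast_pow, ← Real.rpow_natCast, ← Real.rpow_natCast, ← Real.rpow_mul hz'.le,
    ← Real.rpow_add hz']
  congr 1
  ring

theorem prob_cert_tow_ge {K h e z i : ℕ} {α : ℝ} (hK : 1 ≤ K) (hz : K + 6 ≤ z)
    (hzi : z ^ 4 = tow (i + 2)) (hh : e + e / K + 18 ≤ h) (hh' : 24 ≤ h)
    (he : (e : ℝ) + 6 ≤ h * α) (he' : h * α ≤ e + 7) :
    1 - (K + 6) * ((z ^ h : ℕ) : ℝ) ^ 2 * Real.exp (-(z / 2)) ≤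
      prob (z ^ h) (((z ^ h : ℕ) : ℝ) ^ (-α)) (fun G => ∃ F, Cert G F K) := by
  have hz1 : (1 : ℝ) ≤ z := by exact_mod_cast (show 1 ≤ z by omega)
  have htower := exists_towerCert (k := i + 2) (by omega)
  rw [← hzi] at htower
  obtain ⟨Seg, Bit, Mk, htower⟩ := htower
  refine prob_cert_pow_ge hK hz hh hh' ?_ ?_ htower
  · rw [rpow_neg_mul_pow (by omega)]
    exact Real.rpow_le_one_of_one_le_of_nonpos hz1 (by push_cast; linarith)
  · rw [rpow_neg_mul_pow (by omega)]
    exact Real.one_le_rpow hz1 (by push_cast; linarith)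

/-- For every δ > 0 there exist m ∈ ℕ and a first-order sentence φ in the
language L_m such that for every α with 0 < α < 1 − δ, the probability that G(n, n^{−α})
EMSO-satisfies φ does not converge as n → ∞. -/
theorem stmt1 (δ : ℝ) (hδ : 0 < δ) :
    ∃ m : ℕ, ∃ φ : (Lang m).Sentence,
      ∀ α : ℝ, 0 < α → α < 1 - δ →
        ¬ ∃ l : ℝ,
            Tendsto (fun n : ℕ => prob n ((n : ℝ) ^ (-α)) (fun G => EMSOSat G φ))
              atTop (nhds l) := by
  obtain ⟨K, hK⟩ := exists_nat_ge (2 / δ)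
  have hK1 : 1 ≤ K := by
    have : (0 : ℝ) < K := lt_of_lt_of_le (by positivity) hK
    exact_mod_cast this
  obtain ⟨φ, hφ⟩ := exists_sentence K
  refine ⟨K + 7, φ, fun α h0 h1 => ?_⟩
  rintro ⟨l, hl⟩
  simp only [hφ] at hl
  have hl0 : l = 0 := by
    have hlim : Tendsto (fun i => 4 ^ tow (i + 2) + 1) atTop atTop := by
      refine tendsto_atTop_mono (fun i => ?_) tendsto_id
      have e1 : i + 2 ≤ tow (i + 2) := tow_strictMono.le_apply
      have e2 : tow (i + 2) < 4 ^ tow (i + 2) := Nat.lt_pow_self (by norm_num)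
      show i ≤ _
      omega
    refine tendsto_nhds_unique (hl.comp hlim) (tendsto_const_nhds.congr fun i => ?_)
    simp only [Function.comp_apply, not_cert, exists_false]
    exact (prob_false _ _).symm
  obtain ⟨h, e, hh, hh', he, he'⟩ := exists_exponents hδ h0 h1 hK
  choose z hzi hz using exists_pow_four_eq_tow
  have hz' : Tendsto z atTop atTop := tendsto_atTop_mono hzi tendsto_id
  have hl1 : 1 ≤ l := by
    refine le_of_tendsto_of_tendsto ((tendsto_cert_error K h).comp hz')
      (hl.comp ((tendsto_pow_atTop (by omega : h ≠ 0)).comp hz')) ?_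
    filter_upwards [hz'.eventually_ge_atTop (K + 6)] with i hi
    exact prob_cert_tow_ge hK1 hi (hz i) hh hh' he he'
  linarith
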